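/- arXiv:0909.0694 — 2 statements merged into one kernel-verified Lean document; each statement's English description precedes it below -/
import Mathlib

section
/- For every n ≥ 3 there exists a flag simplicial complex Γ whose f-vector is the γ-vector of the type D_n Coxeter complex; that is, for every i ≥ 0 the number of faces of Γ of cardinality i equals #{ŵ ∈ Des_n^D : pk(ŵ) = i}. In particular this sequence satisfies the Kruskal–Katona inequalities. -/
open Finset

attribute [local instance] Classical.propDecidable

/-- The value `w_i` of the permutation word `w = w_1 ⋯ w_n` of `[n] = {1,…,n}`
(one-indexed); by convention the value is `0` outside the range, so `w_0 = 0`. -/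
def pval (n : ℕ) (w : Equiv.Perm (Fin n)) (i : ℕ) : ℕ :=
  if h : 1 ≤ i ∧ i ≤ n then ((w ⟨i - 1, by omega⟩ : Fin n) : ℕ) + 1 else 0

/-- The set of peaks of `0w`: positions `i ∈ [n-1]` with `w_{i-1} < w_i > w_{i+1}`
(where `w_0 = 0`). -/
def pkSet (n : ℕ) (w : Equiv.Perm (Fin n)) : Finset ℕ :=
  (Finset.Icc 1 (n - 1)).filter fun i =>
    pval n w (i - 1) < pval n w i ∧ pval n w (i + 1) < pval n w i

/-- `pk(0w)`, the number of peaks of `0w`. -/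
def pk (n : ℕ) (w : Equiv.Perm (Fin n)) : ℕ := (pkSet n w).card

/-- A decorated permutation of `[n]`: a permutation together with a color in
`{0,1,2,3}` (i.e. `Fin 4`) for each peak of `0w`, the color being `0` away from peaks. -/
def IsDecorated (n : ℕ) (p : Equiv.Perm (Fin n) × (Fin n → Fin 4)) : Prop :=
  ∀ j : Fin n, (j : ℕ) ∉ pkSet n p.1 → p.2 j = 0

/-- Membership in `Des_n^D`: a decorated permutation `(w, c)` such that either
`w_1 < w_2 < w_3`, or both `max{w_1,w_2,w_3} ≠ w_3` and the color of the first bar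
(the bar at the smallest peak position) lies in `{0,1}`. -/
def InDesD (n : ℕ) (p : Equiv.Perm (Fin n) × (Fin n → Fin 4)) : Prop :=
  IsDecorated n p ∧
  ((pval n p.1 1 < pval n p.1 2 ∧ pval n p.1 2 < pval n p.1 3) ∨
    ((pval n p.1 3 < pval n p.1 1 ∨ pval n p.1 3 < pval n p.1 2) ∧
      ∀ j : Fin n, (j : ℕ) ∈ pkSet n p.1 → (∀ q ∈ pkSet n p.1, (j : ℕ) ≤ q) →
        (p.2 j = 0 ∨ p.2 j = 1)))

/-- Insert the new maximal letter after the first `p` letters of the word of `w`. -/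
def insertMax {n : ℕ} (w : Equiv.Perm (Fin n)) (p : Fin (n + 1)) : Equiv.Perm (Fin (n + 1)) :=
  (finSuccEquiv' p).trans ((Equiv.optionCongr w).trans (finSuccEquiv' (Fin.last n)).symm)

theorem insertMax_self {n : ℕ} (w : Equiv.Perm (Fin n)) (p : Fin (n + 1)) :
    insertMax w p p = Fin.last n := by
  simp [insertMax]

theorem insertMax_succAbove {n : ℕ} (w : Equiv.Perm (Fin n)) (p : Fin (n + 1)) (i : Fin n) :
    insertMax w p (p.succAbove i) = (w i).castSucc := by
  simp [insertMax]

theorem insertMax_bijective (n : ℕ) :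
    Function.Bijective fun x : Equiv.Perm (Fin n) × Fin (n + 1) => insertMax x.1 x.2 := by
  rw [Fintype.bijective_iff_injective_and_card]
  constructor
  · rintro ⟨w, p⟩ ⟨w', p'⟩ h
    have h : insertMax w p = insertMax w' p' := h
    have hp : p = p' := by
      apply (insertMax w p).injective
      rw [insertMax_self, h, insertMax_self]
    subst hp
    have hw : w = w' := by
      ext i
      have := congrArg (fun e : Equiv.Perm (Fin (n + 1)) => ((e (p.succAbove i) : Fin (n + 1)) : ℕ)) h
      simpa [insertMax_succAbove] using this
    rw [hw]
  · simp [Fintype.card_perm, Nat.factorial_succ, mul_comm]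

theorem pval_le (n : ℕ) (w : Equiv.Perm (Fin n)) (i : ℕ) : pval n w i ≤ n := by
  unfold pval
  split_ifs with h
  · exact (w ⟨i - 1, by omega⟩).isLt
  · omega

theorem pval_insertMax {n : ℕ} (w : Equiv.Perm (Fin n)) (p : Fin (n + 1)) (i : ℕ) :
    pval (n + 1) (insertMax w p) i =
      if i ≤ p then pval n w i else if i = p + 1 then n + 1 else pval n w (i - 1) := by
  have hp := p.isLt
  split_ifs with h1 h2
  · unfold pval
    by_cases h : 1 ≤ i
    · rw [dif_pos ⟨h, by omega⟩, dif_pos ⟨h, by omega⟩]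
      have : (⟨i - 1, by omega⟩ : Fin (n + 1)) = p.succAbove ⟨i - 1, by omega⟩ := by
        rw [Fin.succAbove_of_castSucc_lt]
        · rfl
        · rw [Fin.lt_def]; simp; omega
      rw [this, insertMax_succAbove]
      rfl
    · rw [dif_neg (by omega), dif_neg (by omega)]
  · unfold pval
    rw [dif_pos ⟨by omega, by omega⟩]
    have : (⟨i - 1, by omega⟩ : Fin (n + 1)) = p := by
      ext; simp; omega
    rw [this, insertMax_self]
    simp
  · unfold pval
    by_cases h : i ≤ n + 1
    · rw [dif_pos ⟨by omega, h⟩, dif_pos ⟨by omega, by omega⟩]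
      have : (⟨i - 1, by omega⟩ : Fin (n + 1)) = p.succAbove ⟨i - 1 - 1, by omega⟩ := by
        rw [Fin.succAbove_of_le_castSucc]
        · ext; simp; omega
        · rw [Fin.le_def]; simp; omega
      rw [this, insertMax_succAbove]
      rfl
    · rw [dif_neg (by omega), dif_neg (by omega)]

theorem mem_pkSet {n : ℕ} {w : Equiv.Perm (Fin n)} {i : ℕ} :
    i ∈ pkSet n w ↔ (1 ≤ i ∧ i ≤ n - 1) ∧
      pval n w (i - 1) < pval n w i ∧ pval n w (i + 1) < pval n w i := by
  simp [pkSet]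

theorem succ_notMem_pkSet {n : ℕ} {w : Equiv.Perm (Fin n)} {i : ℕ} (h : i ∈ pkSet n w) :
    i + 1 ∉ pkSet n w := by
  rw [mem_pkSet] at h ⊢
  simp only [Nat.add_sub_cancel]
  omega

theorem mem_pkSet_insertMax {n : ℕ} (w : Equiv.Perm (Fin n)) (p : Fin (n + 1)) (i : ℕ) :
    i ∈ pkSet (n + 1) (insertMax w p) ↔
      (i < p ∧ i ∈ pkSet n w) ∨ (i = p + 1 ∧ (p : ℕ) < n) ∨
        ((p : ℕ) + 2 < i ∧ i - 1 ∈ pkSet n w) := by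
  have hp := p.isLt
  have hle := pval_le n w
  rw [mem_pkSet, mem_pkSet, mem_pkSet]
  simp only [pval_insertMax]
  rcases lt_trichotomy i ((p : ℕ) + 1) with h | h | h
  · rcases Nat.lt_or_ge i p with h' | h'
    · rw [if_pos (by omega), if_pos (by omega), if_pos (by omega)]
      omega
    · have : i = p := by omega
      subst this
      have := hle p
      simp
      omega
  · subst h
    have h1 := hle p
    have h2 := hle (p + 1)
    simp
    omega
  · rcases Nat.lt_or_ge ((p : ℕ) + 2) i with h' | h'
    · rw [if_neg (by omega), if_neg (by omega), if_neg (by omega), if_neg (by omega),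
        if_neg (by omega), if_neg (by omega)]
      have : i + 1 - 1 = i - 1 + 1 := by omega
      rw [this]
      omega
    · have : i = p + 2 := by omega
      subst this
      have h1 := hle (p + 1)
      simp
      omega

/-- How the number of elements of a sparse set of peaks changes on inserting a maximal letter. -/
theorem card_insert_peak {n p : ℕ} {S T : Finset ℕ} (hS : ∀ i ∈ S, 1 ≤ i ∧ i + 1 ≤ n)
    (hadj : ∀ i ∈ S, i + 1 ∉ S) (hp : p ≤ n)
    (hT : ∀ i, i ∈ T ↔ (i < p ∧ i ∈ S) ∨ (i = p + 1 ∧ p < n) ∨ (p + 2 < i ∧ i - 1 ∈ S)) :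
    T.card = if p = n ∨ p ∈ S ∨ p + 1 ∈ S then S.card else S.card + 1 := by
  set A := S.filter (· < p)
  set B := S.filter (p + 1 < ·)
  set M : Finset ℕ := if p < n then {p + 1} else ∅ with hM
  have hTe : T = (A ∪ M) ∪ B.map (addRightEmbedding 1) := by
    ext i
    rw [hT]
    simp only [A, B, hM, mem_union, mem_filter, mem_map, addRightEmbedding_apply]
    constructor
    · rintro (h | h | h)
      · exact Or.inl (Or.inl ⟨h.2, h.1⟩)
      · left; right; rw [if_pos h.2]; simp [h.1]
      · exact Or.inr ⟨i - 1, ⟨h.2, by omega⟩, by omega⟩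
    · rintro ((h | h) | ⟨j, h, rfl⟩)
      · exact Or.inl ⟨h.2, h.1⟩
      · split_ifs at h with h'
        · exact Or.inr (Or.inl ⟨by simpa using h, h'⟩)
        · simp at h
      · exact Or.inr (Or.inr ⟨by omega, by simpa using h.1⟩)
  have hMmem : ∀ i ∈ M, i = p + 1 := by
    intro i hi
    rw [hM] at hi
    split_ifs at hi
    · simpa using hi
    · simp at hi
  have hMcard : M.card = if p < n then 1 else 0 := by
    rw [hM]; split_ifs <;> simp
  have hTc : T.card = A.card + M.card + B.card := by
    rw [hTe, card_union_of_disjoint, card_union_of_disjoint, card_map]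
    · rw [disjoint_left]
      intro i hi hi'
      have := hMmem i hi'
      simp [A] at hi
      omega
    · rw [disjoint_left]
      intro i hi hi'
      simp only [mem_union, mem_map, addRightEmbedding_apply, B, A, mem_filter] at hi hi'
      obtain ⟨j, hj, rfl⟩ := hi'
      rcases hi with hi | hi
      · omega
      · have := hMmem _ hi
        omega
  set C := S.filter fun i => i = p ∨ i = p + 1
  have hSc : S.card = A.card + C.card + B.card := by
    have hSe : S = (A ∪ C) ∪ B := by
      ext i
      simp only [A, B, C, mem_union, mem_filter]
      constructor
      · intro h
        by_cases h1 : i < p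
        · simp [h, h1]
        · by_cases h2 : p + 1 < i
          · simp [h, h2]
          · have : i = p ∨ i = p + 1 := by omega
            simp [h, this]
      · tauto
    conv_lhs => rw [hSe]
    rw [card_union_of_disjoint, card_union_of_disjoint]
    · rw [disjoint_left]
      intro i hi hi'
      simp [A, C] at hi hi'
      omega
    · rw [disjoint_left]
      intro i hi hi'
      simp [A, B, C] at hi hi'
      omega
  have hCcard : C.card = if p ∈ S ∨ p + 1 ∈ S then 1 else 0 := by
    split_ifs with h
    · rcases h with h | h
      · rw [card_eq_one]
        refine ⟨p, ?_⟩
        ext i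
        have := hadj p h
        simp only [C, mem_filter, mem_singleton]
        constructor
        · rintro ⟨h1, rfl | rfl⟩
          · rfl
          · contradiction
        · rintro rfl; simp [h]
      · rw [card_eq_one]
        refine ⟨p + 1, ?_⟩
        ext i
        have := fun h' => hadj p h' h
        simp only [C, mem_filter, mem_singleton]
        constructor
        · rintro ⟨h1, rfl | rfl⟩
          · contradiction
          · rfl
        · rintro rfl; simp [h]
    · rw [card_eq_zero]
      ext i
      simp only [C, mem_filter, notMem_empty, iff_false]
      rintro ⟨h1, rfl | rfl⟩ <;> tauto
  rw [hTc, hMcard]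
  by_cases hpn : p = n
  · have h1 : ¬ (p ∈ S ∨ p + 1 ∈ S) := by
      rintro (h | h) <;> have := hS _ h <;> omega
    rw [if_neg h1] at hCcard
    simp only [hpn, true_or, if_true, lt_irrefl, if_false]
    omega
  · have : p < n := by omega
    by_cases h1 : p ∈ S ∨ p + 1 ∈ S
    · rw [if_pos h1] at hCcard
      rw [if_pos (Or.inr h1), if_pos this]
      omega
    · rw [if_neg h1] at hCcard
      have h2 : ¬ (p = n ∨ p ∈ S ∨ p + 1 ∈ S) := by
        rintro (h | h)
        · exact hpn h
        · exact h1 h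
      rw [if_pos this, if_neg h2]
      omega

/-- Summing a two-valued function over the insertion positions from `m` on. -/
theorem sum_insert_positions {n m : ℕ} {S : Finset ℕ} (hS : ∀ i ∈ S, 1 ≤ i ∧ i + 1 ≤ n)
    (hadj : ∀ i ∈ S, i + 1 ∉ S) (hm : m ≤ n) (hmS : m ∉ S) (a b : ℚ) :
    ∑ p ∈ Finset.Icc m n, (if p = n ∨ p ∈ S ∨ p + 1 ∈ S then a else b) =
      (2 * (S.filter (m < ·)).card + 1) * a +
        ((n : ℚ) - m - 2 * (S.filter (m < ·)).card) * b := by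
  set R := S.filter (m < ·)
  have hcard : ((Finset.Icc m n).filter fun p => p = n ∨ p ∈ S ∨ p + 1 ∈ S).card
      = 2 * R.card + 1 := by
    have : ((Finset.Icc m n).filter fun p => p = n ∨ p ∈ S ∨ p + 1 ∈ S)
        = ({n} ∪ R) ∪ R.image (· - 1) := by
      ext p
      simp only [R, mem_filter, mem_Icc, mem_union, mem_singleton, mem_image]
      constructor
      · rintro ⟨h1, rfl | h | h⟩
        · simp
        · have : p ≠ m := fun h' => hmS (h' ▸ h)
          exact Or.inl (Or.inr ⟨h, by omega⟩)
        · exact Or.inr ⟨p + 1, ⟨h, by omega⟩, by omega⟩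
      · rintro ((rfl | h) | ⟨q, h, rfl⟩)
        · simp [hm]
        · have := hS p h.1
          exact ⟨by omega, by tauto⟩
        · have := hS q h.1
          have h' : q - 1 + 1 = q := by omega
          rw [h']
          exact ⟨by omega, by tauto⟩
    rw [this, card_union_of_disjoint, card_union_of_disjoint, card_image_of_injOn, card_singleton]
    · ring
    · intro x hx y hy hxy
      simp only [R, coe_filter, Set.mem_ofPred_eq] at hx hy hxy
      omega
    · rw [disjoint_left]
      intro x hx hx'
      simp only [mem_singleton] at hx
      subst hx
      have := hS _ (mem_filter.1 hx').1
      omega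
    · rw [disjoint_left]
      intro x hx hx'
      simp only [R, mem_union, mem_singleton, mem_filter, mem_image] at hx hx'
      obtain ⟨q, hq, rfl⟩ := hx'
      have h1 := hS q hq.1
      rcases hx with hx | hx
      · omega
      · refine hadj _ hx.1 ?_
        have h' : q - 1 + 1 = q := by omega
        rw [h']
        exact hq.1
  rw [sum_ite, sum_const, sum_const, hcard]
  have hneg := card_filter_add_card_filter_not (s := Finset.Icc m n)
    (fun p => p = n ∨ p ∈ S ∨ p + 1 ∈ S)
  rw [hcard, Nat.card_Icc] at hneg
  have hneg' : (((Finset.Icc m n).filter fun p => ¬ (p = n ∨ p ∈ S ∨ p + 1 ∈ S)).card : ℚ)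
      = n - m - 2 * R.card := by
    have hsum := Nat.sub_add_cancel (show m ≤ n + 1 by omega)
    rw [← hneg] at hsum
    have := congrArg (Nat.cast : ℕ → ℚ) hsum
    push_cast at this
    linarith
  rw [nsmul_eq_mul, nsmul_eq_mul, hneg']
  push_cast
  ring

/-- The contribution of a permutation with peak set `S` to the weighted face count, where `φ c k`
is the weight of a face of class `c` with `k` vertices. -/
def peakWeight (φ : ℕ → ℕ → ℚ) (S : Finset ℕ) : ℚ :=
  4 ^ S.card *
    if 1 ∈ S then φ 1 S.card / 2
    else if 2 ∈ S then φ 2 S.card / 2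
    else φ 0 S.card - 2 * φ 1 (S.card + 1)

/-- The action on weights that is adjoint to passing from `n` to `n + 1`. -/
def transfer (n : ℕ) (φ : ℕ → ℕ → ℚ) : ℕ → ℕ → ℚ
  | 0, k => (2 * k + 1) * φ 0 k + 4 * (n - 2 - 2 * k) * φ 0 (k + 1) + 4 * φ 1 (k + 1)
      + 4 * φ 2 (k + 1)
  | 1, k => 2 * k * φ 1 k + φ 2 k + 4 * (n - 2 * k) * φ 1 (k + 1)
  | _, k => 2 * k * φ 2 k + 2 * φ 0 k + 4 * (n - 1 - 2 * k) * φ 2 (k + 1)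

theorem transfer_two (n : ℕ) (φ : ℕ → ℕ → ℚ) (k : ℕ) :
    transfer n φ 2 k = 2 * k * φ 2 k + 2 * φ 0 k + 4 * (n - 1 - 2 * k) * φ 2 (k + 1) :=
  rfl

theorem sum_peakWeight_insert {n : ℕ} (hn : 2 ≤ n) {S : Finset ℕ} {T : ℕ → Finset ℕ}
    (hS : ∀ i ∈ S, 1 ≤ i ∧ i + 1 ≤ n) (hadj : ∀ i ∈ S, i + 1 ∉ S)
    (hT : ∀ p ≤ n, ∀ i, i ∈ T p ↔
      (i < p ∧ i ∈ S) ∨ (i = p + 1 ∧ p < n) ∨ (p + 2 < i ∧ i - 1 ∈ S))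
    (φ : ℕ → ℕ → ℚ) :
    ∑ p ∈ range (n + 1), peakWeight φ (T p) = peakWeight (transfer n φ) S := by
  have hcard : ∀ p ≤ n, (T p).card = if p = n ∨ p ∈ S ∨ p + 1 ∈ S then S.card else S.card + 1 :=
    fun p hp => card_insert_peak hS hadj hp (hT p hp)
  have h0S : 0 ∉ S := fun h => by have := hS 0 h; omega
  have hone : ∀ p ≤ n, 2 ≤ p → (1 ∈ T p ↔ 1 ∈ S) := by
    intro p hp hp2
    rw [hT p hp]
    constructor
    · rintro (h | h | h)
      · exact h.2
      · omega
      · omega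
    · intro h; exact Or.inl ⟨by omega, h⟩
  have htwo : ∀ p ≤ n, 2 ≤ p → (2 ∈ T p ↔ 2 < p ∧ 2 ∈ S) := by
    intro p hp hp2
    rw [hT p hp]
    constructor
    · rintro (h | h | h)
      · exact h
      · omega
      · omega
    · intro h; exact Or.inl h
  have h1T0 : 1 ∈ T 0 := by rw [hT 0 (by omega)]; right; left; omega
  have h1T1 : 1 ∉ T 1 := by
    rw [hT 1 (by omega)]
    rintro (h | h | h) <;> omega
  have h2T1 : 2 ∈ T 1 := by rw [hT 1 (by omega)]; right; left; omega
  have hsplit : range (n + 1) = insert 0 (insert 1 (Finset.Icc 2 n)) := by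
    ext i; simp; omega
  have hsplit' : Finset.Icc 2 n = insert 2 (Finset.Icc 3 n) := by
    ext i; simp; omega
  rw [hsplit, sum_insert (by simp), sum_insert (by simp)]
  have e0 : peakWeight φ (T 0) = 4 ^ (T 0).card * (φ 1 (T 0).card / 2) := by
    simp [peakWeight, h1T0]
  have e1 : peakWeight φ (T 1) = 4 ^ (T 1).card * (φ 2 (T 1).card / 2) := by
    simp [peakWeight, h1T1, h2T1]
  rw [e0, e1]
  have c0 := hcard 0 (by omega)
  have c1 := hcard 1 (by omega)
  by_cases h1 : 1 ∈ S
  · have h2 : 2 ∉ S := hadj 1 h1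
    rw [if_pos (by simp [h1])] at c0 c1
    have hR : (S.filter (2 < ·)).card + 1 = S.card := by
      have : S.filter (2 < ·) = S.erase 1 := by
        ext i
        simp only [mem_filter, mem_erase]
        constructor
        · rintro ⟨h, h'⟩; exact ⟨by omega, h⟩
        · rintro ⟨h, h'⟩
          have := hS i h'
          have : i ≠ 2 := fun e => h2 (e ▸ h')
          exact ⟨h', by omega⟩
      rw [this, card_erase_add_one h1]
    have hsum : ∑ p ∈ Finset.Icc 2 n, peakWeight φ (T p) = ∑ p ∈ Finset.Icc 2 n,
        if p = n ∨ p ∈ S ∨ p + 1 ∈ S then 4 ^ S.card * (φ 1 S.card / 2)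
        else 4 ^ (S.card + 1) * (φ 1 (S.card + 1) / 2) := by
      refine sum_congr rfl fun p hp => ?_
      rw [mem_Icc] at hp
      rw [peakWeight, if_pos ((hone p hp.2 hp.1).2 h1), hcard p hp.2]
      split_ifs <;> rfl
    rw [hsum, sum_insert_positions hS hadj hn h2, c0, c1, peakWeight, if_pos h1, transfer, ← hR]
    push_cast
    ring
  · by_cases h2 : 2 ∈ S
    · have h3 : 3 ∉ S := hadj 2 h2
      have hn3 : 3 ≤ n := (hS 2 h2).2
      rw [if_neg (by simp [h0S, h1]; omega)] at c0
      rw [if_pos (by simp [h2])] at c1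
      have hR : (S.filter (3 < ·)).card + 1 = S.card := by
        have : S.filter (3 < ·) = S.erase 2 := by
          ext i
          simp only [mem_filter, mem_erase]
          constructor
          · rintro ⟨h, h'⟩; exact ⟨by omega, h⟩
          · rintro ⟨h, h'⟩
            have := hS i h'
            have : i ≠ 3 := fun e => h3 (e ▸ h')
            have : i ≠ 1 := fun e => h1 (e ▸ h')
            exact ⟨h', by omega⟩
        rw [this, card_erase_add_one h2]
      have hsum : ∑ p ∈ Finset.Icc 3 n, peakWeight φ (T p) = ∑ p ∈ Finset.Icc 3 n,
          if p = n ∨ p ∈ S ∨ p + 1 ∈ S then 4 ^ S.card * (φ 2 S.card / 2)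
          else 4 ^ (S.card + 1) * (φ 2 (S.card + 1) / 2) := by
        refine sum_congr rfl fun p hp => ?_
        rw [mem_Icc] at hp
        rw [peakWeight, if_neg (by rw [hone p hp.2 (by omega)]; exact h1),
          if_pos ((htwo p hp.2 (by omega)).2 ⟨by omega, h2⟩), hcard p hp.2]
        split_ifs <;> rfl
      have e2 : peakWeight φ (T 2) = 4 ^ S.card * (φ 0 S.card - 2 * φ 1 (S.card + 1)) := by
        rw [peakWeight, if_neg (by rw [hone 2 hn le_rfl]; exact h1),
          if_neg (by rw [htwo 2 hn le_rfl]; omega), hcard 2 hn, if_pos (by simp [h2])]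
      rw [hsplit', sum_insert (by simp), hsum, sum_insert_positions hS hadj hn3 h3, e2, c0, c1,
        peakWeight, if_neg h1, if_pos h2, transfer_two, ← hR]
      push_cast
      ring
    · rw [if_neg (by simp [h0S, h1]; omega)] at c0
      rw [if_neg (by simp [h1, h2]; omega)] at c1
      have hR : S.filter (2 < ·) = S := by
        rw [filter_eq_self]
        intro i hi
        have := hS i hi
        have : i ≠ 1 := fun e => h1 (e ▸ hi)
        have : i ≠ 2 := fun e => h2 (e ▸ hi)
        omega
      have hsum : ∑ p ∈ Finset.Icc 2 n, peakWeight φ (T p) = ∑ p ∈ Finset.Icc 2 n,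
          if p = n ∨ p ∈ S ∨ p + 1 ∈ S then 4 ^ S.card * (φ 0 S.card - 2 * φ 1 (S.card + 1))
          else 4 ^ (S.card + 1) * (φ 0 (S.card + 1) - 2 * φ 1 (S.card + 2)) := by
        refine sum_congr rfl fun p hp => ?_
        rw [mem_Icc] at hp
        rw [peakWeight, if_neg (by rw [hone p hp.2 (by omega)]; exact h1),
          if_neg (by rw [htwo p hp.2 (by omega)]; exact fun h => h2 h.2), hcard p hp.2]
        split_ifs <;> rfl
      rw [hsum, sum_insert_positions hS hadj hn h2, hR, c0, c1, peakWeight, if_neg h1, if_neg h2,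
        transfer, transfer]
      push_cast
      ring

theorem sum_peakWeight_succ {n : ℕ} (hn : 2 ≤ n) (φ : ℕ → ℕ → ℚ) :
    ∑ w : Equiv.Perm (Fin (n + 1)), peakWeight φ (pkSet (n + 1) w) =
      ∑ w : Equiv.Perm (Fin n), peakWeight (transfer n φ) (pkSet n w) := by
  rw [← (insertMax_bijective n).sum_comp fun w => peakWeight φ (pkSet (n + 1) w),
    Fintype.sum_prod_type]
  refine sum_congr rfl fun w _ => ?_
  have hrange := Fin.sum_univ_eq_sum_range
    (fun p => peakWeight φ (pkSet (n + 1) (insertMax w (Fin.ofNat (n + 1) p)))) (n + 1)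
  have hof : ∀ p : Fin (n + 1), Fin.ofNat (n + 1) (p : ℕ) = p := by
    intro p; ext; simp
  simp only [hof] at hrange
  rw [hrange]
  refine sum_peakWeight_insert hn ?_ (fun i => succ_notMem_pkSet) ?_ φ
  · intro i hi
    rw [mem_pkSet] at hi
    omega
  · intro p hp i
    rw [mem_pkSet_insertMax]
    have : ((Fin.ofNat (n + 1) p : Fin (n + 1)) : ℕ) = p := by
      simp [Nat.mod_eq_of_lt (show p < n + 1 by omega)]
    rw [this]

theorem pkSet_two_one : pkSet 2 1 = ∅ := by
  ext i
  simp only [mem_pkSet, notMem_empty, iff_false]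
  rintro ⟨h, -, h'⟩
  have : i = 1 := by omega
  subst this
  simp [pval] at h'

theorem pkSet_two_swap : pkSet 2 (Equiv.swap 0 1) = {1} := by
  ext i
  simp only [mem_pkSet, mem_singleton]
  constructor
  · omega
  · rintro rfl
    simp [pval]

theorem sum_peakWeight_two (φ : ℕ → ℕ → ℚ) :
    ∑ w : Equiv.Perm (Fin 2), peakWeight φ (pkSet 2 w) = φ 0 0 := by
  have huniv : (Finset.univ : Finset (Equiv.Perm (Fin 2))) = {1, Equiv.swap 0 1} := by decide
  rw [huniv, sum_pair (by decide), pkSet_two_one, pkSet_two_swap]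
  simp [peakWeight]
  ring

/-- The graph obtained from `G` by adding independent vertices `w : W`, each joined to the
vertices `v` of `G` with `N w v`. -/
def addIndependent {V W : Type} (G : SimpleGraph V) (N : W → V → Prop) : SimpleGraph (V ⊕ W) where
  Adj
    | Sum.inl u, Sum.inl v => G.Adj u v
    | Sum.inl u, Sum.inr w => N w u
    | Sum.inr w, Sum.inl u => N w u
    | Sum.inr _, Sum.inr _ => False
  symm := ⟨by
    rintro (u | u) (v | v) h
    · exact SimpleGraph.Adj.symm (G := G) h
    · exact h
    · exact h
    · exact h⟩
  loopless := ⟨by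
    rintro (u | u) h
    · exact G.irrefl h
    · exact h⟩

/-- The faces of the flag complex of `G`. -/
noncomputable def cliqueFaces {V : Type} [Fintype V] (G : SimpleGraph V) : Finset (Finset V) :=
  Finset.univ.filter fun F => G.IsClique (F : Set V)

theorem mem_cliqueFaces {V : Type} [Fintype V] {G : SimpleGraph V} {F : Finset V} :
    F ∈ cliqueFaces G ↔ G.IsClique (F : Set V) := by
  simp [cliqueFaces]

section

variable {V W : Type} {G : SimpleGraph V} {N : W → V → Prop}

theorem isClique_map_inl {F : Finset V} :
    (addIndependent G N).IsClique (F.map Function.Embedding.inl : Finset (V ⊕ W)) ↔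
      G.IsClique (F : Set V) := by
  simp only [SimpleGraph.isClique_iff, Set.Pairwise, mem_coe, mem_map,
    Function.Embedding.inl_apply]
  constructor
  · intro h u hu v hv huv
    exact h ⟨u, hu, rfl⟩ ⟨v, hv, rfl⟩ (by simpa using huv)
  · rintro h _ ⟨u, hu, rfl⟩ _ ⟨v, hv, rfl⟩ huv
    exact h hu hv (by simpa using huv)

theorem isClique_insert_inr {F : Finset V} {w : W} :
    (addIndependent G N).IsClique
        (insert (Sum.inr w) (F.map Function.Embedding.inl) : Finset (V ⊕ W)) ↔
      G.IsClique (F : Set V) ∧ ∀ v ∈ F, N w v := by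
  rw [coe_insert, SimpleGraph.isClique_insert, isClique_map_inl]
  refine and_congr_right fun _ => ?_
  constructor
  · intro h v hv
    exact h (Sum.inl v) (by simpa using hv) (by simp)
  · intro h x hx _
    simp only [coe_map, Set.mem_image, mem_coe] at hx
    obtain ⟨v, hv, rfl⟩ := hx
    exact h v hv

theorem map_inl_toLeft {F : Finset (V ⊕ W)} (h : ∀ w, Sum.inr w ∉ F) :
    F.toLeft.map Function.Embedding.inl = F := by
  ext (v | w)
  · simp
  · simpa using h w

theorem card_insert_inr_map [DecidableEq (V ⊕ W)] (w : W) (F : Finset V) :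
    (insert (Sum.inr w) (F.map Function.Embedding.inl) : Finset (V ⊕ W)).card = F.card + 1 := by
  rw [card_insert_of_notMem (by simp), card_map]

theorem insert_inr_toLeft {F : Finset (V ⊕ W)}
    (hF : (addIndependent G N).IsClique (F : Set (V ⊕ W))) {w : W} (hw : Sum.inr w ∈ F) :
    insert (Sum.inr w) (F.toLeft.map Function.Embedding.inl) = F := by
  ext (v | u)
  · simp
  · simp only [mem_insert, mem_map, Function.Embedding.inl_apply, reduceCtorEq, and_false,
      exists_false, or_false]
    constructor
    · rintro h; rw [h]; exact hw
    · intro h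
      by_contra hne
      exact hF h hw hne

theorem sum_cliques_addIndependent [Fintype V] [Fintype W] (h : Finset (V ⊕ W) → ℚ) :
    ∑ F ∈ cliqueFaces (addIndependent G N), h F =
      ∑ F ∈ cliqueFaces G, h (F.map Function.Embedding.inl) +
      ∑ w : W, ∑ F ∈ cliqueFaces G with ∀ v ∈ F, N w v,
        h (insert (Sum.inr w) (F.map Function.Embedding.inl)) := by
  rw [← sum_filter_add_sum_filter_not _ (fun F : Finset (V ⊕ W) => ∀ w, Sum.inr w ∉ F)]
  congr 1
  · symm
    refine sum_bij' (fun F _ => F.map Function.Embedding.inl) (fun F _ => F.toLeft) ?_ ?_ ?_ ?_ ?_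
    · intro F hF
      simp only [mem_filter, mem_cliqueFaces] at hF ⊢
      exact ⟨isClique_map_inl.2 hF, by simp⟩
    · intro F hF
      simp only [mem_filter, mem_cliqueFaces] at hF ⊢
      rw [← isClique_map_inl (N := N), map_inl_toLeft hF.2]
      exact hF.1
    · intro F hF
      ext v; simp
    · intro F hF
      exact map_inl_toLeft (mem_filter.1 hF).2
    · intro F hF; rfl
  · rw [sum_sigma']
    symm
    refine sum_bij (fun x _ => insert (Sum.inr x.1) (x.2.map Function.Embedding.inl)) ?_ ?_ ?_ ?_
    · rintro ⟨w, F⟩ hF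
      simp only [mem_sigma, mem_filter, mem_cliqueFaces, mem_univ, true_and] at hF ⊢
      exact ⟨isClique_insert_inr.2 hF, fun h => h w (by simp)⟩
    · rintro ⟨w, F⟩ - ⟨w', F'⟩ - he
      have hw : Sum.inr w ∈ insert (Sum.inr w') (F'.map Function.Embedding.inl) := by
        rw [← he]; simp
      have hw : w = w' := by simpa using hw
      subst hw
      have hF : F = F' := by
        ext v
        have := congrArg (fun A : Finset (V ⊕ W) => Sum.inl v ∈ A) he
        simpa using this
      rw [hF]
    · intro F hF
      simp only [mem_filter, mem_cliqueFaces, not_forall, not_not] at hF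
      obtain ⟨hF, w, hw⟩ := hF
      refine ⟨⟨w, F.toLeft⟩, ?_, insert_inr_toLeft hF hw⟩
      simp only [mem_sigma, mem_filter, mem_cliqueFaces, mem_univ, true_and]
      rw [← isClique_insert_inr, insert_inr_toLeft hF hw]
      exact hF
    · intro x hx; rfl

/-- Summing over the cliques in the neighborhoods of all vertices amounts to summing over the
cliques with a marked vertex. -/
theorem sum_cliques_in_neighborhoods [Fintype V] (h : V → Finset V → ℚ) :
    ∑ v : V, ∑ F ∈ cliqueFaces G with ∀ u ∈ F, G.Adj v u, h v F =
      ∑ F ∈ cliqueFaces G, ∑ v ∈ F, h v (F.erase v) := by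
  rw [sum_sigma', sum_sigma']
  refine sum_bij' (fun x _ => ⟨insert x.1 x.2, x.1⟩) (fun y _ => ⟨y.2, y.1.erase y.2⟩)
    ?_ ?_ ?_ ?_ ?_
  · rintro ⟨v, F⟩ hF
    simp only [mem_sigma, mem_filter, mem_cliqueFaces, mem_univ, true_and, mem_insert_self,
      and_true] at hF ⊢
    rw [coe_insert, SimpleGraph.isClique_insert]
    exact ⟨hF.1, fun u hu _ => hF.2 u hu⟩
  · rintro ⟨F, v⟩ hF
    simp only [mem_sigma, mem_filter, mem_cliqueFaces, mem_univ, true_and] at hF ⊢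
    refine ⟨hF.1.subset (by simp), fun u hu => ?_⟩
    rw [mem_erase] at hu
    exact hF.1 hF.2 hu.2 hu.1.symm
  · rintro ⟨v, F⟩ hF
    simp only [mem_sigma, mem_filter, mem_cliqueFaces, mem_univ, true_and] at hF ⊢
    rw [erase_insert]
    exact fun hv => G.irrefl (hF.2 v hv)
  · rintro ⟨F, v⟩ hF
    simp only [mem_sigma, mem_cliqueFaces] at hF ⊢
    rw [insert_erase hF.2]
  · rintro ⟨v, F⟩ hF
    simp only [mem_sigma, mem_filter, mem_cliqueFaces, mem_univ, true_and] at hF ⊢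
    rw [erase_insert]
    exact fun hv => G.irrefl (hF.2 v hv)

end

/-- The combinatorial type of a vertex of the complex. -/
inductive VertexLabel
  | pair (a b : ℕ)
  | low
  | lowPlus (a : ℕ)

namespace VertexLabel

/-- The set of letters in `[n]` blocked by a vertex. -/
def support : VertexLabel → Finset ℕ
  | pair a b => {a, b}
  | low => {1, 2}
  | lowPlus a => {1, 2, a}

/-- The class of a vertex: a face with first bar at position `1` or `2` contains exactly one vertex
of rank `1` or `2`, respectively. -/
def rank : VertexLabel → ℕ
  | pair _ _ => 0
  | low => 1
  | lowPlus _ => 2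

/-- Labels that may occur in the complex for `[n]`. -/
def Valid (n : ℕ) : VertexLabel → Prop
  | pair a b => 3 ≤ a ∧ a < b ∧ b ≤ n
  | low => True
  | lowPlus a => 3 ≤ a ∧ a ≤ n

/-- The label of the copy indexed by `j` of a vertex in passing from `n` to `n + 1`. -/
def copy (n : ℕ) : VertexLabel → ℕ → VertexLabel
  | pair a b, _ => pair a b
  | low, j => if j = 1 then low else lowPlus (n + 1)
  | lowPlus a, j => if j = a then lowPlus a else pair a (n + 1)

/-- The label of a new vertex at the letter `j` in passing from `n` to `n + 1`. -/
def fresh (n j : ℕ) : VertexLabel :=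
  if j = 1 then low else if j = 2 then lowPlus (n + 1) else pair j (n + 1)

theorem support_subset {n : ℕ} (hn : 2 ≤ n) {L : VertexLabel} (hL : L.Valid n) :
    L.support ⊆ Finset.Icc 1 n := by
  intro x hx
  rw [mem_Icc]
  cases L <;> simp only [support, Valid, mem_insert, mem_singleton] at hx hL <;> omega

theorem Valid.succ {n : ℕ} {L : VertexLabel} (hL : L.Valid n) : L.Valid (n + 1) := by
  cases L <;> simp only [Valid] at hL ⊢ <;> omega

theorem Valid.copy {n : ℕ} (hn : 2 ≤ n) {L : VertexLabel} (hL : L.Valid n) (j : ℕ) :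
    (L.copy n j).Valid (n + 1) := by
  cases L <;> simp only [VertexLabel.copy] <;> (try split_ifs) <;>
    simp only [Valid] at hL ⊢ <;> omega

theorem valid_fresh {n j : ℕ} (hn : 2 ≤ n) (hj : 1 ≤ j) (hjn : j ≤ n) :
    (fresh n j).Valid (n + 1) := by
  unfold fresh
  split_ifs <;> simp only [Valid] <;> omega

theorem support_copy_subset (n : ℕ) (L : VertexLabel) (j : ℕ) :
    (L.copy n j).support ⊆ insert (n + 1) L.support := by
  intro x
  cases L <;> simp only [copy] <;> (try split_ifs) <;>
    simp only [support, mem_insert, mem_singleton] <;> tauto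

theorem one_mem_support_of_rank_ne_zero {L : VertexLabel} (hL : L.rank ≠ 0) : 1 ∈ L.support := by
  cases L <;> simp [rank, support] at hL ⊢

theorem two_mem_support_of_rank_ne_zero {L : VertexLabel} (hL : L.rank ≠ 0) : 2 ∈ L.support := by
  cases L <;> simp [rank, support] at hL ⊢

theorem three_le_of_mem_support {n : ℕ} {L : VertexLabel} (hL : L.Valid n) (h0 : L.rank = 0)
    {x : ℕ} (hx : x ∈ L.support) : 3 ≤ x := by
  cases L <;> simp only [rank, support, Valid, mem_insert, mem_singleton] at * <;> omega

theorem card_support {n : ℕ} {L : VertexLabel} (hL : L.Valid n) :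
    L.support.card = if L.rank = 2 then 3 else 2 := by
  cases L with
  | pair a b =>
    simp only [Valid] at hL
    simp [support, rank, card_pair (show a ≠ b by omega)]
  | low => simp [support, rank]
  | lowPlus a =>
    simp only [Valid] at hL
    rw [support, card_insert_of_notMem, card_pair] <;> simp [rank] <;> omega

theorem disjoint_support_copy {n : ℕ} {L M : VertexLabel} (hn : 2 ≤ n) (hM : M.Valid n)
    (h : Disjoint L.support M.support) (j : ℕ) :
    Disjoint (L.copy n j).support M.support := by
  rw [disjoint_left] at h ⊢
  intro x hx hxM
  have h1 := support_copy_subset n L j hx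
  have h2 := mem_Icc.1 (support_subset hn hM hxM)
  rw [mem_insert] at h1
  rcases h1 with h1 | h1
  · omega
  · exact h h1 hxM

theorem disjoint_support_fresh {n j : ℕ} {M : VertexLabel} (hn : 2 ≤ n) (hM : M.Valid n)
    (hj : j ∉ M.support) : Disjoint (fresh n j).support M.support := by
  have hsub := support_subset hn hM
  have hlow : j = 1 ∨ j = 2 → M.rank = 0 := by
    intro h
    by_contra h0
    rcases h with rfl | rfl
    · exact hj (one_mem_support_of_rank_ne_zero h0)
    · exact hj (two_mem_support_of_rank_ne_zero h0)
  rw [disjoint_left]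
  intro x hx hxM
  have h2 := mem_Icc.1 (hsub hxM)
  unfold fresh at hx
  split_ifs at hx with h h'
  · have := three_le_of_mem_support hM (hlow (Or.inl h)) hxM
    simp only [support, mem_insert, mem_singleton] at hx
    omega
  · have := three_le_of_mem_support hM (hlow (Or.inr h')) hxM
    simp only [support, mem_insert, mem_singleton] at hx
    omega
  · simp only [support, mem_insert, mem_singleton] at hx
    rcases hx with rfl | hx
    · exact hj hxM
    · omega

/-- The sum of a function of the rank over all copies of a vertex of rank zero. -/
theorem sum_copy_of_rank_eq_zero {n : ℕ} {L : VertexLabel} (hL : L.Valid n) (h0 : L.rank = 0)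
    (f : ℕ → ℚ) : ∑ j ∈ L.support, f (L.copy n j).rank = 2 * f 0 := by
  cases L with
  | pair a b =>
    simp only [Valid] at hL
    rw [support, sum_pair (by omega)]
    simp only [copy, rank]
    ring
  | low => simp [rank] at h0
  | lowPlus a => simp [rank] at h0

theorem sum_copy_of_rank_eq_one {n : ℕ} {L : VertexLabel} (h1 : L.rank = 1)
    (f : ℕ → ℚ) : ∑ j ∈ L.support, f (L.copy n j).rank = f 1 + f 2 := by
  cases L with
  | pair a b => simp [rank] at h1
  | low =>
    rw [support, sum_pair (by omega)]
    simp [copy, rank]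
  | lowPlus a => simp [rank] at h1

theorem sum_copy_of_rank_eq_two {n : ℕ} {L : VertexLabel} (hL : L.Valid n) (h2 : L.rank = 2)
    (f : ℕ → ℚ) : ∑ j ∈ L.support, f (L.copy n j).rank = f 2 + 2 * f 0 := by
  cases L with
  | pair a b => simp [rank] at h2
  | low => simp [rank] at h2
  | lowPlus a =>
    simp only [Valid] at hL
    rw [support, sum_insert (by simp; omega), sum_pair (by omega)]
    simp only [copy, if_neg (show ¬ 1 = a by omega), if_neg (show ¬ 2 = a by omega), if_true, rank]
    ring

theorem rank_le_two (L : VertexLabel) : L.rank ≤ 2 := by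
  cases L <;> simp [rank]

theorem rank_fresh {n j : ℕ} (hj : 3 ≤ j) : (fresh n j).rank = 0 := by
  rw [fresh, if_neg (by omega), if_neg (by omega), rank]

end VertexLabel

open VertexLabel in
theorem transfer_face {V : Type} {n : ℕ} (hn : 2 ≤ n) {l : V → VertexLabel} {F : Finset V}
    (hl : ∀ v ∈ F, (l v).Valid n)
    (hd : ∀ u ∈ F, ∀ v ∈ F, u ≠ v → Disjoint (l u).support (l v).support) (φ : ℕ → ℕ → ℚ) :
    φ (F.sup fun v => (l v).rank) F.card +
      ∑ v ∈ F, ∑ j ∈ (l v).support,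
        φ (max ((l v).copy n j).rank ((F.erase v).sup fun v => (l v).rank))
          ((F.erase v).card + 1) +
      4 * ∑ j ∈ Finset.Icc 1 n with ∀ v ∈ F, j ∉ (l v).support,
        φ (max (fresh n j).rank (F.sup fun v => (l v).rank)) (F.card + 1) =
    transfer n φ (F.sup fun v => (l v).rank) F.card := by
  set cl : Finset V → ℕ := fun F => F.sup fun v => (l v).rank with hcl
  change φ (cl F) F.card + ∑ v ∈ F, ∑ j ∈ (l v).support,
      φ (max ((l v).copy n j).rank (cl (F.erase v))) ((F.erase v).card + 1) +
    4 * ∑ j ∈ Finset.Icc 1 n with ∀ v ∈ F, j ∉ (l v).support,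
      φ (max (fresh n j).rank (cl F)) (F.card + 1) = transfer n φ (cl F) F.card
  set free := (Finset.Icc 1 n).filter fun j => ∀ v ∈ F, j ∉ (l v).support with hfree
  have hcardfree : (free.card : ℚ) = n - ∑ v ∈ F, ((l v).support.card : ℚ) := by
    have h1 : free = Finset.Icc 1 n \ F.biUnion fun v => (l v).support := by
      ext j; simp [hfree]
    have h2 : (F.biUnion fun v => (l v).support) ⊆ Finset.Icc 1 n :=
      biUnion_subset.2 fun v hv => support_subset hn (hl v hv)
    have h3 := card_sdiff_add_card_eq_card h2
    rw [← h1, card_biUnion hd, Nat.card_Icc] at h3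
    have := congrArg (Nat.cast : ℕ → ℚ) h3
    push_cast at this
    linarith
  have herase : ∀ v ∈ F, (F.erase v).card + 1 = F.card := fun v hv => card_erase_add_one hv
  by_cases h0 : ∀ v ∈ F, (l v).rank = 0
  · have hzero : ∀ A ⊆ F, cl A = 0 := by
      intro A hA
      rw [← Nat.le_zero, hcl]
      exact Finset.sup_le fun v hv => (h0 v (hA hv)).le
    have hkeep : ∑ v ∈ F, ∑ j ∈ (l v).support,
        φ (max ((l v).copy n j).rank (cl (F.erase v))) ((F.erase v).card + 1)
        = F.card * (2 * φ 0 F.card) := by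
      rw [← nsmul_eq_mul, ← sum_const]
      refine sum_congr rfl fun v hv => ?_
      rw [herase v hv, hzero _ (erase_subset _ _)]
      simp only [Nat.max_zero]
      exact sum_copy_of_rank_eq_zero (hl v hv) (h0 v hv) fun c => φ c F.card
    have hcf : (free.card : ℚ) = n - 2 * F.card := by
      rw [hcardfree, sum_congr rfl fun v hv => by rw [card_support (hl v hv), h0 v hv], sum_const]
      simp [mul_comm]
    have hmem : ∀ j, 1 ≤ j → j ≤ 2 → j ∈ free := by
      intro j h1 h2
      simp only [hfree, mem_filter, mem_Icc]
      refine ⟨⟨h1, by omega⟩, fun v hv hj => ?_⟩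
      have := three_le_of_mem_support (hl v hv) (h0 v hv) hj
      omega
    have h1f := hmem 1 (by omega) (by omega)
    have h2f : 2 ∈ free.erase 1 := mem_erase.2 ⟨by omega, hmem 2 (by omega) (by omega)⟩
    have hfresh : ∑ j ∈ free, φ (max (fresh n j).rank (cl F)) (F.card + 1) =
        φ 1 (F.card + 1) + φ 2 (F.card + 1) + (n - 2 - 2 * F.card) * φ 0 (F.card + 1) := by
      rw [hzero F Subset.rfl, ← add_sum_erase _ _ h1f, ← add_sum_erase _ _ h2f]
      have hrest : ∑ j ∈ (free.erase 1).erase 2, φ (max (fresh n j).rank 0) (F.card + 1) =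
          ∑ j ∈ (free.erase 1).erase 2, φ 0 (F.card + 1) := by
        refine sum_congr rfl fun j hj => ?_
        simp only [hfree, mem_erase, mem_filter, mem_Icc] at hj
        rw [rank_fresh (by omega), Nat.max_zero]
      have hc1 := card_erase_add_one h1f
      have hc2 := card_erase_add_one h2f
      have hc : (((free.erase 1).erase 2).card : ℚ) + 1 + 1 = free.card := by
        exact_mod_cast (by omega : ((free.erase 1).erase 2).card + 1 + 1 = free.card)
      have hc' : (((free.erase 1).erase 2).card : ℚ) = n - 2 - 2 * F.card := by linarith
      rw [hrest, sum_const, nsmul_eq_mul, hc']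
      simp only [fresh, if_true, if_neg (show ¬ 2 = 1 by omega), rank, Nat.max_zero]
      ring
    rw [hkeep, hfresh, hzero F Subset.rfl, transfer]
    ring
  · push Not at h0
    obtain ⟨v₀, hv₀, hr⟩ := h0
    have hothers : ∀ v ∈ F, v ≠ v₀ → (l v).rank = 0 := by
      intro v hv hne
      by_contra h
      exact disjoint_left.1 (hd v hv v₀ hv₀ hne) (one_mem_support_of_rank_ne_zero h)
        (one_mem_support_of_rank_ne_zero hr)
    set c := (l v₀).rank with hc
    have hclass : ∀ A ⊆ F, v₀ ∈ A → cl A = c := by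
      intro A hA hv
      apply le_antisymm
      · refine Finset.sup_le fun v hvA => ?_
        by_cases h : v = v₀
        · rw [h]
        · rw [hothers v (hA hvA) h]; omega
      · exact Finset.le_sup (f := fun v => (l v).rank) hv
    have hclass' : cl (F.erase v₀) = 0 := by
      rw [← Nat.le_zero, hcl]
      refine Finset.sup_le fun v hv => ?_
      rw [mem_erase] at hv
      exact (hothers v hv.2 hv.1).le
    have hkeep : ∑ v ∈ F, ∑ j ∈ (l v).support,
        φ (max ((l v).copy n j).rank (cl (F.erase v))) ((F.erase v).card + 1)
        = ∑ j ∈ (l v₀).support, φ ((l v₀).copy n j).rank F.card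
          + (F.card - 1) * (2 * φ c F.card) := by
      rw [← add_sum_erase _ _ hv₀, hclass', herase v₀ hv₀]
      simp only [Nat.max_zero]
      congr 1
      have : ((F.card : ℚ) - 1) = (F.erase v₀).card := by
        rw [← herase v₀ hv₀]; push_cast; ring
      rw [this, ← nsmul_eq_mul, ← sum_const]
      refine sum_congr rfl fun v hv => ?_
      rw [mem_erase] at hv
      rw [herase v hv.2, hclass _ (erase_subset _ _) (mem_erase.2 ⟨hv.1.symm, hv₀⟩)]
      rw [sum_copy_of_rank_eq_zero (hl v hv.2) (hothers v hv.2 hv.1)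
        fun d => φ (max d c) F.card]
      simp
    have hcf : (free.card : ℚ) = n - 2 * (F.card - 1) - (l v₀).support.card := by
      have hrest : ∑ v ∈ F.erase v₀, ((l v).support.card : ℚ) = ∑ v ∈ F.erase v₀, 2 := by
        refine sum_congr rfl fun v hv => ?_
        rw [mem_erase] at hv
        rw [card_support (hl v hv.2), hothers v hv.2 hv.1]
        simp
      rw [hcardfree, ← add_sum_erase _ _ hv₀, hrest, sum_const]
      rw [← herase v₀ hv₀, nsmul_eq_mul]
      push_cast
      ring
    have hfresh : ∑ j ∈ free, φ (max (fresh n j).rank (cl F)) (F.card + 1) =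
        (n - 2 * (F.card - 1) - (l v₀).support.card) * φ c (F.card + 1) := by
      rw [← hcf, ← nsmul_eq_mul, ← sum_const]
      refine sum_congr rfl fun j hj => ?_
      simp only [hfree, mem_filter, mem_Icc] at hj
      have h1 : j ≠ 1 := fun h => hj.2 v₀ hv₀ (h ▸ one_mem_support_of_rank_ne_zero hr)
      have h2 : j ≠ 2 := fun h => hj.2 v₀ hv₀ (h ▸ two_mem_support_of_rank_ne_zero hr)
      rw [rank_fresh (by omega), hclass F Subset.rfl hv₀, Nat.zero_max]
    rw [hkeep, hfresh, hclass F Subset.rfl hv₀, card_support (hl v₀ hv₀), ← hc]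
    have hc12 : c = 1 ∨ c = 2 := by
      have := rank_le_two (l v₀)
      omega
    rcases hc12 with h | h
    · rw [sum_copy_of_rank_eq_one (hc ▸ h) fun d => φ d F.card, h, transfer,
        if_neg (by omega)]
      push_cast
      ring
    · rw [sum_copy_of_rank_eq_two (hl v₀ hv₀) (hc ▸ h) fun d => φ d F.card, h, transfer_two,
        if_pos rfl]
      push_cast
      ring

/-- A flag complex whose faces, weighted by class and size, are counted by the peak sets of
permutations of `[n]`. -/
theorem exists_labelled_graph {n : ℕ} (hn : 2 ≤ n) :
    ∃ (V : Type) (_ : Fintype V) (G : SimpleGraph V) (l : V → VertexLabel),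
      (∀ v, (l v).Valid n) ∧
      (∀ u v, G.Adj u v → Disjoint (l u).support (l v).support) ∧
      ∀ φ : ℕ → ℕ → ℚ, ∑ F ∈ cliqueFaces G, φ (F.sup fun v => (l v).rank) F.card =
        ∑ w : Equiv.Perm (Fin n), peakWeight φ (pkSet n w) := by
  induction n, hn using Nat.le_induction with
  | base =>
    refine ⟨Empty, inferInstance, ⊥, Empty.elim, fun v => v.elim, fun u => u.elim, fun φ => ?_⟩
    rw [sum_peakWeight_two]
    have : cliqueFaces (⊥ : SimpleGraph Empty) = {∅} := by
      ext F
      simp [mem_cliqueFaces, eq_empty_of_isEmpty F]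
    rw [this]
    simp
  | succ n hn ih =>
    obtain ⟨V, _, G, l, hl, hd, hsum⟩ := ih
    let W := (Σ v : V, (l v).support) ⊕ (Fin n × Fin 4)
    let N : W → V → Prop := Sum.elim (fun x => G.Adj x.1) fun y v => (y.1 : ℕ) + 1 ∉ (l v).support
    let lW : W → VertexLabel :=
      Sum.elim (fun x => (l x.1).copy n x.2) fun y => VertexLabel.fresh n (y.1 + 1)
    have hdW : ∀ w v, N w v → Disjoint (lW w).support (l v).support := by
      rintro (x | y) v h
      · exact VertexLabel.disjoint_support_copy hn (hl v) (hd _ _ h) _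
      · exact VertexLabel.disjoint_support_fresh hn (hl v) h
    refine ⟨V ⊕ W, inferInstance, addIndependent G N, Sum.elim l lW, ?_, ?_, fun φ => ?_⟩
    · rintro (v | x | y)
      · exact (hl v).succ
      · exact (hl x.1).copy hn _
      · exact VertexLabel.valid_fresh hn (by omega) (by omega)
    · rintro (u | w) (v | w') h
      · exact hd u v h
      · exact (hdW w' u h).symm
      · exact hdW w v h
      · exact h.elim
    · rw [sum_peakWeight_succ hn, ← hsum, sum_cliques_addIndependent]
      simp only [sup_insert, sup_map, card_map, Sum.elim_inr,
        card_insert_inr_map]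
      change ∑ F ∈ cliqueFaces G, φ (F.sup fun v => (l v).rank) F.card + ∑ w : W,
        ∑ F ∈ cliqueFaces G with ∀ v ∈ F, N w v,
          φ (max (lW w).rank (F.sup fun v => (l v).rank)) (F.card + 1) = _
      rw [Fintype.sum_sum_type, Fintype.sum_sigma, Fintype.sum_prod_type]
      have hcopies : ∑ v : V, ∑ j : (l v).support, ∑ F ∈ cliqueFaces G with
            ∀ u ∈ F, N (Sum.inl ⟨v, j⟩) u,
            φ (max (lW (Sum.inl ⟨v, j⟩)).rank (F.sup fun v => (l v).rank)) (F.card + 1) =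
          ∑ F ∈ cliqueFaces G, ∑ v ∈ F, ∑ j ∈ (l v).support,
            φ (max ((l v).copy n j).rank ((F.erase v).sup fun v => (l v).rank))
              ((F.erase v).card + 1) := by
        rw [← sum_cliques_in_neighborhoods fun v F => ∑ j ∈ (l v).support,
            φ (max ((l v).copy n j).rank (F.sup fun v => (l v).rank)) (F.card + 1)]
        refine sum_congr rfl fun v _ => ?_
        have hN : ∀ j : (l v).support, ∑ F ∈ cliqueFaces G with ∀ u ∈ F, N (Sum.inl ⟨v, j⟩) u,
              φ (max (lW (Sum.inl ⟨v, j⟩)).rank (F.sup fun v => (l v).rank)) (F.card + 1) =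
            ∑ F ∈ cliqueFaces G with ∀ u ∈ F, G.Adj v u,
              φ (max ((l v).copy n j).rank (F.sup fun v => (l v).rank)) (F.card + 1) := fun j =>
          sum_congr (by ext; rw [mem_filter, mem_filter]; rfl) fun _ _ => rfl
        rw [sum_congr rfl fun j _ => hN j, sum_comm]
        refine sum_congr rfl fun F _ => ?_
        exact sum_coe_sort (l v).support fun j =>
          φ (max ((l v).copy n j).rank (F.sup fun v => (l v).rank)) (F.card + 1)
      have hfresh : ∑ i : Fin n, ∑ c : Fin 4, ∑ F ∈ cliqueFaces G with
            ∀ u ∈ F, N (Sum.inr (i, c)) u,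
            φ (max (lW (Sum.inr (i, c))).rank (F.sup fun v => (l v).rank)) (F.card + 1) =
          ∑ F ∈ cliqueFaces G, 4 * ∑ j ∈ Finset.Icc 1 n with ∀ v ∈ F, j ∉ (l v).support,
            φ (max (VertexLabel.fresh n j).rank (F.sup fun v => (l v).rank)) (F.card + 1) := by
        have hc : ∀ i : Fin n, ∑ c : Fin 4, ∑ F ∈ cliqueFaces G with
              ∀ u ∈ F, N (Sum.inr (i, c)) u,
              φ (max (lW (Sum.inr (i, c))).rank (F.sup fun v => (l v).rank)) (F.card + 1) =
            4 * ∑ F ∈ cliqueFaces G, if ∀ v ∈ F, (i : ℕ) + 1 ∉ (l v).support then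
              φ (max (VertexLabel.fresh n (i + 1)).rank (F.sup fun v => (l v).rank))
                (F.card + 1) else 0 := by
          intro i
          rw [← sum_filter]
          calc _ = ∑ _c : Fin 4, ∑ F ∈ cliqueFaces G with ∀ v ∈ F, (i : ℕ) + 1 ∉ (l v).support,
                φ (max (VertexLabel.fresh n (i + 1)).rank (F.sup fun v => (l v).rank))
                  (F.card + 1) :=
                sum_congr rfl fun c _ => sum_congr (by ext; rw [mem_filter, mem_filter]; rfl) fun _ _ => rfl
            _ = _ := by simp
        rw [sum_congr rfl fun i _ => hc i, ← mul_sum, sum_comm, ← mul_sum]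
        congr 1
        refine sum_congr rfl fun F _ => ?_
        rw [sum_filter, Fin.sum_univ_eq_sum_range fun i =>
          if ∀ v ∈ F, i + 1 ∉ (l v).support then
            φ (max (VertexLabel.fresh n (i + 1)).rank (F.sup fun v => (l v).rank))
              (F.card + 1) else 0,
          range_eq_Ico, sum_Ico_add' (fun j => if ∀ v ∈ F, j ∉ (l v).support then
            φ (max (VertexLabel.fresh n j).rank (F.sup fun v => (l v).rank))
              (F.card + 1) else 0) 0 n 1]
        rfl
      rw [hcopies, hfresh, ← sum_add_distrib, ← sum_add_distrib]
      refine sum_congr rfl fun F hF => ?_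
      rw [mem_cliqueFaces] at hF
      rw [← transfer_face hn (fun v _ => hl v) (fun u hu v hv huv => hd u v (hF hu hv huv))]
      rw [← add_assoc]
      congr!

theorem pval_zero (n : ℕ) (w : Equiv.Perm (Fin n)) : pval n w 0 = 0 := by
  simp [pval]

theorem pval_pos {n : ℕ} (w : Equiv.Perm (Fin n)) {i : ℕ} (h1 : 1 ≤ i) (hi : i ≤ n) :
    0 < pval n w i := by
  simp [pval, h1, hi]

theorem pval_ne {n : ℕ} (w : Equiv.Perm (Fin n)) {i j : ℕ} (hi : 1 ≤ i) (hij : i < j)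
    (hj : j ≤ n) : pval n w i ≠ pval n w j := by
  unfold pval
  rw [dif_pos ⟨hi, by omega⟩, dif_pos ⟨by omega, hj⟩]
  intro h
  have := congrArg Fin.val (w.injective (Fin.ext (Nat.succ_injective h)))
  simp only at this
  omega

theorem one_mem_pkSet {n : ℕ} (hn : 2 ≤ n) (w : Equiv.Perm (Fin n)) :
    1 ∈ pkSet n w ↔ pval n w 2 < pval n w 1 := by
  have := pval_pos w le_rfl (show 1 ≤ n by omega)
  have := pval_zero n w
  simp only [mem_pkSet, Nat.sub_self, Nat.reduceAdd]
  omega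

theorem two_mem_pkSet {n : ℕ} (hn : 3 ≤ n) (w : Equiv.Perm (Fin n)) :
    2 ∈ pkSet n w ↔ pval n w 1 < pval n w 2 ∧ pval n w 3 < pval n w 2 := by
  simp only [mem_pkSet, Nat.reduceSub, Nat.reduceAdd]
  omega

theorem card_colorings {n : ℕ} {S : Finset ℕ} (hS : ∀ i ∈ S, i < n) (B : ℕ → Finset (Fin 4)) :
    (Finset.univ.filter fun c : Fin n → Fin 4 =>
      (∀ j : Fin n, (j : ℕ) ∉ S → c j = 0) ∧ ∀ j : Fin n, (j : ℕ) ∈ S → c j ∈ B j).card =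
      ∏ i ∈ S, (B i).card := by
  have : (Finset.univ.filter fun c : Fin n → Fin 4 =>
      (∀ j : Fin n, (j : ℕ) ∉ S → c j = 0) ∧ ∀ j : Fin n, (j : ℕ) ∈ S → c j ∈ B j) =
      Fintype.piFinset fun j : Fin n => if (j : ℕ) ∈ S then B j else {0} := by
    ext c
    simp only [mem_filter, mem_univ, true_and, Fintype.mem_piFinset, ← forall_and]
    refine forall_congr' fun j => ?_
    split_ifs with h <;> simp [h]
  rw [this, Fintype.card_piFinset,
    Fin.prod_univ_eq_prod_range (fun i => (if i ∈ S then B i else {0}).card) n]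
  refine (prod_subset (fun i hi => mem_range.2 (hS i hi)) fun i _ hi => by simp [hi]).symm.trans ?_
  exact prod_congr rfl fun i hi => by rw [if_pos hi]

theorem lt_of_mem_pkSet {n : ℕ} {w : Equiv.Perm (Fin n)} {i : ℕ} (h : i ∈ pkSet n w) : i < n := by
  rw [mem_pkSet] at h
  omega

theorem card_decorations (n : ℕ) (w : Equiv.Perm (Fin n)) :
    (Finset.univ.filter fun c : Fin n → Fin 4 => IsDecorated n (w, c)).card =
      4 ^ (pkSet n w).card := by
  have := card_colorings (fun i => lt_of_mem_pkSet (w := w) (i := i)) fun _ => Finset.univ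
  simp only [mem_univ, implies_true, and_true, card_univ, Fintype.card_fin, prod_const] at this
  rw [← this]
  congr!

theorem two_mul_card_decorations_first_bar {n : ℕ} {w : Equiv.Perm (Fin n)}
    (hw : (pkSet n w).Nonempty) :
    2 * (Finset.univ.filter fun c : Fin n → Fin 4 => IsDecorated n (w, c) ∧
      ∀ j : Fin n, (j : ℕ) ∈ pkSet n w → (∀ q ∈ pkSet n w, (j : ℕ) ≤ q) →
        (c j = 0 ∨ c j = 1)).card = 4 ^ (pkSet n w).card := by
  have h := card_colorings (fun i => lt_of_mem_pkSet (w := w) (i := i))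
    fun i => if ∀ q ∈ pkSet n w, i ≤ q then {0, 1} else Finset.univ
  have hset : (Finset.univ.filter fun c : Fin n → Fin 4 => IsDecorated n (w, c) ∧
      ∀ j : Fin n, (j : ℕ) ∈ pkSet n w → (∀ q ∈ pkSet n w, (j : ℕ) ≤ q) →
        (c j = 0 ∨ c j = 1)) = (Finset.univ.filter fun c : Fin n → Fin 4 =>
      (∀ j : Fin n, (j : ℕ) ∉ pkSet n w → c j = 0) ∧ ∀ j : Fin n, (j : ℕ) ∈ pkSet n w →
        c j ∈ if ∀ q ∈ pkSet n w, (j : ℕ) ≤ q then ({0, 1} : Finset (Fin 4)) else Finset.univ) := by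
    refine filter_congr fun c _ => and_congr_right fun _ => ?_
    refine forall_congr' fun j => forall_congr' fun _ => ?_
    split_ifs with h'
    · rw [mem_insert, mem_singleton]
      exact ⟨fun h => h h', fun h _ => h⟩
    · simp only [h', false_imp_iff, mem_univ]
  rw [hset, h]
  set S := pkSet n w
  have hmin := S.min'_mem hw
  rw [← mul_prod_erase S _ hmin, if_pos fun q hq => S.min'_le q hq]
  have herase : ∀ i ∈ S.erase (S.min' hw),
      (if ∀ q ∈ S, i ≤ q then ({0, 1} : Finset (Fin 4)) else Finset.univ).card = 4 := by
    intro i hi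
    rw [if_neg, card_univ, Fintype.card_fin]
    intro h'
    exact (mem_erase.1 hi).1 (le_antisymm (h' _ hmin) (S.min'_le i (mem_erase.1 hi).2))
  rw [prod_congr rfl herase, prod_const, ← card_erase_add_one hmin, pow_succ]
  have : ({0, 1} : Finset (Fin 4)).card = 2 := by decide
  rw [this]
  ring

theorem card_typeD_decorations {n : ℕ} (hn : 3 ≤ n) (w : Equiv.Perm (Fin n)) :
    ((Finset.univ.filter fun c : Fin n → Fin 4 => InDesD n (w, c)).card : ℚ) =
      if pval n w 1 < pval n w 2 ∧ pval n w 2 < pval n w 3 then 4 ^ (pkSet n w).card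
      else if pval n w 2 < pval n w 1 ∧ pval n w 1 < pval n w 3 then 0
      else 4 ^ (pkSet n w).card / 2 := by
  have h12 := pval_ne w (i := 1) (j := 2) (by omega) (by omega) (by omega)
  have h13 := pval_ne w (i := 1) (j := 3) (by omega) (by omega) (by omega)
  have h23 := pval_ne w (i := 2) (j := 3) (by omega) (by omega) (by omega)
  split_ifs with hX hZ
  · have := congrArg (Nat.cast : ℕ → ℚ) (card_decorations n w)
    push_cast at this
    rw [← this]
    congr 2
    ext c
    simp [InDesD, hX]
  · rw [Nat.cast_eq_zero, card_eq_zero, filter_eq_empty_iff]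
    rintro c - ⟨-, h | ⟨h, -⟩⟩ <;> simp only at h <;> omega
  · have hY : pval n w 3 < pval n w 1 ∨ pval n w 3 < pval n w 2 := by omega
    have hne : (pkSet n w).Nonempty := by
      by_cases h : pval n w 2 < pval n w 1
      · exact ⟨1, (one_mem_pkSet (by omega) w).2 h⟩
      · exact ⟨2, (two_mem_pkSet hn w).2 (by omega)⟩
    rw [eq_div_iff two_ne_zero, mul_comm]
    have := two_mul_card_decorations_first_bar hne
    have := congrArg (Nat.cast : ℕ → ℚ) this
    push_cast at this
    rw [← this]
    congr 3
    ext c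
    simp only [InDesD, hX, hY, false_or, true_and]

theorem pval_mul_swap {n : ℕ} (hn : 2 ≤ n) (w : Equiv.Perm (Fin n)) (i : ℕ) :
    pval n (w * Equiv.swap ⟨0, by omega⟩ ⟨1, by omega⟩) i =
      if i = 1 then pval n w 2 else if i = 2 then pval n w 1 else pval n w i := by
  split_ifs with h1 h2
  · subst h1
    unfold pval
    rw [dif_pos (by omega), dif_pos (by omega)]
    simp
  · subst h2
    unfold pval
    rw [dif_pos (by omega), dif_pos (by omega)]
    simp
  · unfold pval
    split_ifs with h
    · rw [Equiv.Perm.mul_apply, Equiv.swap_apply_of_ne_of_ne]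
      · rw [ne_eq, Fin.mk.injEq]; omega
      · rw [ne_eq, Fin.mk.injEq]; omega
    · rfl

theorem pkSet_mul_swap {n : ℕ} (hn : 3 ≤ n) {w : Equiv.Perm (Fin n)}
    (hw : pval n w 1 < pval n w 2 ∧ pval n w 2 < pval n w 3) :
    pkSet n (w * Equiv.swap ⟨0, by omega⟩ ⟨1, by omega⟩) = insert 1 (pkSet n w) := by
  have hv := pval_mul_swap (show 2 ≤ n by omega) w
  ext i
  rw [mem_insert]
  by_cases h1 : i = 1
  · subst h1
    rw [one_mem_pkSet (by omega)]
    simp [hv, hw.1]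
  by_cases h2 : i = 2
  · subst h2
    rw [two_mem_pkSet hn, two_mem_pkSet hn]
    simp [hv]
    omega
  rw [mem_pkSet, mem_pkSet, hv i, hv (i + 1), if_neg h1, if_neg h2]
  by_cases h0 : i = 0
  · omega
  rw [if_neg (by omega), if_neg (by omega), hv (i - 1), if_neg (by omega)]
  by_cases h3 : i = 3
  · subst h3
    simp
    omega
  rw [if_neg (by omega)]
  omega

theorem sum_swap_first_two {n : ℕ} (hn : 3 ≤ n) (g : ℕ → ℚ) :
    ∑ w : Equiv.Perm (Fin n), (if pval n w 2 < pval n w 1 ∧ pval n w 1 < pval n w 3 then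
        g (pkSet n w).card else 0) =
      ∑ w : Equiv.Perm (Fin n), if pval n w 1 < pval n w 2 ∧ pval n w 2 < pval n w 3 then
        g ((pkSet n w).card + 1) else 0 := by
  rw [← Equiv.sum_comp (Equiv.mulRight (Equiv.swap (⟨0, by omega⟩ : Fin n) ⟨1, by omega⟩))]
  refine sum_congr rfl fun w _ => ?_
  have hv := pval_mul_swap (show 2 ≤ n by omega) w
  simp only [Equiv.coe_mulRight, hv]
  simp only [OfNat.ofNat_ne_one, if_false, if_true, Nat.reduceEqDiff]
  split_ifs with h
  · rw [pkSet_mul_swap hn h, card_insert_of_notMem]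
    rw [one_mem_pkSet (by omega)]
    omega
  · rfl

theorem sum_peakWeight_eq_typeD {n : ℕ} (hn : 3 ≤ n) (ψ : ℕ → ℚ) :
    ∑ w : Equiv.Perm (Fin n), peakWeight (fun _ => ψ) (pkSet n w) =
      ∑ w : Equiv.Perm (Fin n),
        ((Finset.univ.filter fun c : Fin n → Fin 4 => InDesD n (w, c)).card : ℚ) *
          ψ (pkSet n w).card := by
  have hsw := sum_swap_first_two hn fun k => 4 ^ k / 2 * ψ k
  rw [← sub_eq_zero, ← sum_sub_distrib] at hsw
  rw [← sub_eq_zero, ← sum_sub_distrib, ← hsw]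
  refine sum_congr rfl fun w _ => ?_
  rw [card_typeD_decorations hn, peakWeight]
  simp only [one_mem_pkSet (show 2 ≤ n by omega) w, two_mem_pkSet hn w]
  have h12 := pval_ne w (i := 1) (j := 2) (by omega) (by omega) (by omega)
  have h13 := pval_ne w (i := 1) (j := 3) (by omega) (by omega) (by omega)
  have h23 := pval_ne w (i := 2) (j := 3) (by omega) (by omega) (by omega)
  split_ifs <;> first | omega | ring

theorem card_typeD_eq_sum (n i : ℕ) :
    ((Finset.univ.filter fun p : Equiv.Perm (Fin n) × (Fin n → Fin 4) =>
      InDesD n p ∧ pk n p.1 = i).card : ℚ) =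
      ∑ w : Equiv.Perm (Fin n),
        ((Finset.univ.filter fun c : Fin n → Fin 4 => InDesD n (w, c)).card : ℚ) *
          if (pkSet n w).card = i then 1 else 0 := by
  rw [card_filter, Nat.cast_sum, Fintype.sum_prod_type]
  refine sum_congr rfl fun w _ => ?_
  rw [card_filter, Nat.cast_sum, sum_mul]
  refine sum_congr rfl fun c _ => ?_
  by_cases h1 : InDesD n (w, c) <;> by_cases h2 : (pkSet n w).card = i <;> simp [pk, h1, h2]

/-- There is a flag simplicial complex whose `f`-vector is the `γ`-vector of the
type `D_n` Coxeter complex: its number of faces of cardinality `i` is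
`#{ŵ ∈ Des_n^D : pk ŵ = i}`.  (In particular this sequence satisfies the
Kruskal–Katona inequalities.) -/
theorem gamma_typeD_is_f_vector_of_flag_complex (n : ℕ) (hn : 3 ≤ n) :
    ∃ (V : Type) (_ : Fintype V) (_ : DecidableEq V) (Δ : Finset (Finset V)),
      ∅ ∈ Δ ∧
      (∀ F ∈ Δ, ∀ G ⊆ F, G ∈ Δ) ∧
      (∀ v : V, ({v} : Finset V) ∈ Δ) ∧
      (∀ F : Finset V,
        (∀ a ∈ F, ∀ b ∈ F, a ≠ b → ({a, b} : Finset V) ∈ Δ) → F ∈ Δ) ∧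
      (∀ i : ℕ, (Δ.filter fun F => F.card = i).card =
        (Finset.univ.filter
          fun p : Equiv.Perm (Fin n) × (Fin n → Fin 4) =>
            InDesD n p ∧ pk n p.1 = i).card) := by
  obtain ⟨V, hV, G, l, -, -, hsum⟩ := exists_labelled_graph (show 2 ≤ n by omega)
  refine ⟨V, hV, fun a b => Classical.propDecidable _, cliqueFaces G, ?_, ?_, ?_, ?_, ?_⟩
  · simp [mem_cliqueFaces]
  · intro F hF H hHF
    rw [mem_cliqueFaces] at hF ⊢
    exact hF.subset (coe_subset.2 hHF)
  · intro v
    simp [mem_cliqueFaces]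
  · intro F hF
    rw [mem_cliqueFaces]
    intro a ha b hb hab
    have := hF a ha b hb hab
    rw [mem_cliqueFaces] at this
    exact this (by simp) (by simp) hab
  · intro i
    have h := hsum fun _ k => if k = i then 1 else 0
    rw [sum_peakWeight_eq_typeD hn, ← card_typeD_eq_sum, sum_boole] at h
    exact_mod_cast h
end

section
/- Let d ≥ 2 and let Δ be a flag simplicial complex of dimension d−1 whose geometric realization is homeomorphic to the sphere S^{d−1}, and suppose Δ has exactly 2d+1 vertices (equivalently γ_1(Δ) = 1). Then h(Δ;t) = (1+t)^d + t(1+t)^{d−2}; equivalently, the γ-polynomial of Δ is γ(Δ;t) = 1 + t. -/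
open Polynomial Finset

/-- The geometric realization of a simplicial complex `Δ` with vertices `Fin N`:
the points of the standard simplex on the vertex set whose support is a face. -/
def realize {N : ℕ} (Δ : Finset (Finset (Fin N))) : Set (Fin N → ℝ) :=
  {x | ∃ F ∈ Δ, (∀ v, 0 ≤ x v) ∧ (∀ v, x v ≠ 0 → v ∈ F) ∧ (∑ v, x v) = 1}

/-- The `h`-polynomial `h(Δ;t) = (1-t)^d f(Δ; t/(1-t)) = Σ_{F ∈ Δ} t^{|F|} (1-t)^{d-|F|}`
of a `(d-1)`-dimensional simplicial complex. -/
noncomputable def hPoly (d : ℕ) {N : ℕ} (Δ : Finset (Finset (Fin N))) : Polynomial ℤ :=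
  ∑ F ∈ Δ, X ^ F.card * (1 - X) ^ (d - F.card)

section Topology

open MeasureTheory Metric Module

variable {E : Type*} [NormedAddCommGroup E] [InnerProductSpace ℝ E]

/-- Extending a Lipschitz function that vanishes on a sphere by zero outside of the ball. -/
lemma lipschitzWith_indicator_closedBall {u : E → E} {R : ℝ} {K : NNReal}
    (hu : LipschitzOnWith K u (closedBall 0 R)) (h0 : ∀ x, ‖x‖ = R → u x = 0) :
    LipschitzWith K ((closedBall 0 R).indicator u) := by
  have key : ∀ x y : E, ‖x‖ ≤ R → R < ‖y‖ → ‖u x‖ ≤ K * ‖x - y‖ := by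
    intro x y hx hy
    have hc : Continuous fun t : ℝ ↦ ‖x + t • (y - x)‖ := by fun_prop
    obtain ⟨t, ht, htR⟩ := intermediate_value_Icc (zero_le_one (α := ℝ)) hc.continuousOn
      (show R ∈ Set.Icc _ _ by constructor <;> simp <;> linarith)
    have h1 := hu.dist_le_mul x (by simpa using hx) (x + t • (y - x)) (by simp [htR])
    rw [h0 _ htR, dist_zero_right] at h1
    refine h1.trans (mul_le_mul_of_nonneg_left ?_ K.2)
    rw [dist_self_add_right, norm_smul, norm_sub_rev x y, Real.norm_of_nonneg ht.1]
    exact mul_le_of_le_one_left (norm_nonneg _) ht.2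
  refine LipschitzWith.of_dist_le_mul fun x y ↦ ?_
  by_cases hx : ‖x‖ ≤ R <;> by_cases hy : ‖y‖ ≤ R
  · simpa [Set.indicator, hx, hy] using hu.dist_le_mul x (by simpa using hx) y (by simpa using hy)
  · simpa [Set.indicator, hx, hy, dist_eq_norm] using key x y hx (not_le.1 hy)
  · simpa [Set.indicator, hx, hy, dist_eq_norm, norm_sub_rev] using key y x hy (not_le.1 hx)
  · simp only [Set.indicator, mem_closedBall, dist_zero_right, hx, hy, if_false, dist_self]
    positivity

variable [FiniteDimensional ℝ E]

/-- Values at `1` of polynomials of bounded degree are fixed affine combinations of their values at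
small positive points. -/
lemma exists_interpolation_weights (n : ℕ) {ε : ℝ} (hε : 0 < ε) :
    ∃ (s : Finset ℝ) (w : ℝ → ℝ), (∀ t ∈ s, 0 < t ∧ t < ε) ∧ ∑ t ∈ s, w t = 1 ∧
      ∀ p : ℝ[X], p.natDegree ≤ n → p.eval 1 = ∑ t ∈ s, w t * p.eval t := by
  obtain ⟨s, hs, hcard⟩ := (Set.Ioo_infinite hε).exists_subset_card_eq (n + 1)
  have hne : s.Nonempty := by
    rw [← Finset.card_pos]; omega
  refine ⟨s, fun t ↦ (Lagrange.basis s id t).eval 1, fun t ht ↦ hs ht, ?_, fun p hp ↦ ?_⟩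
  · rw [← eval_finsetSum, Lagrange.sum_basis (Set.injOn_id _) hne, eval_one]
  · have hdeg : p.degree < #s := by
      rw [hcard]
      exact (degree_le_natDegree).trans_lt (by exact_mod_cast Nat.lt_succ_of_le hp)
    conv_lhs => rw [Lagrange.eq_interpolate (Set.injOn_id _) hdeg]
    simp [Lagrange.interpolate_apply, eval_finsetSum, mul_comm]

lemma exists_polynomial_det_one_add_smul (A : E →L[ℝ] E) :
    ∃ p : ℝ[X], p.natDegree ≤ finrank ℝ E ∧
      ∀ t : ℝ, (ContinuousLinearMap.id ℝ E + t • A).det = p.eval t := by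
  let b := finBasis ℝ E
  let M : Matrix _ _ ℝ := LinearMap.toMatrix b b (A : E →ₗ[ℝ] E)
  refine ⟨((X : ℝ[X]) • M.map C + (1 : Matrix _ _ ℝ).map C).det, ?_, fun t ↦ ?_⟩
  · simpa using natDegree_det_X_add_C_le M 1
  · rw [ContinuousLinearMap.det, ← LinearMap.det_toMatrix b, ← coe_evalRingHom, RingHom.map_det]
    congr 1
    ext i j
    simp [M, LinearMap.toMatrix_apply, Matrix.one_apply, Finsupp.single_apply, add_comm, eq_comm,
      apply_ite, mul_comm t]

/-- Small perturbations of the identity which fix the sphere permute the ball. -/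
lemma bijOn_closedBall_id_add_smul {u : E → E} {R : ℝ} {K : NNReal}
    (hu : LipschitzOnWith K u (closedBall 0 R)) (h0 : ∀ x, ‖x‖ = R → u x = 0)
    {t : ℝ} (ht : 0 ≤ t) (htK : t * K < 1) :
    Set.BijOn (fun x ↦ x + t • u x) (closedBall 0 R) (closedBall 0 R) := by
  set g := (closedBall (0 : E) R).indicator u with hg
  have hgL : LipschitzWith K g := lipschitzWith_indicator_closedBall hu h0
  have hsm : LipschitzWith (t.toNNReal * K) fun x ↦ t • g x := by
    refine LipschitzWith.of_dist_le_mul fun x y ↦ ?_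
    rw [dist_smul₀, NNReal.coe_mul, mul_assoc, Real.coe_toNNReal _ ht, Real.norm_of_nonneg ht]
    exact mul_le_mul_of_nonneg_left (hgL.dist_le_mul x y) ht
  have hlt : t.toNNReal * K < 1 := by
    rw [← NNReal.coe_lt_coe, NNReal.coe_mul, Real.coe_toNNReal _ ht]; simpa using htK
  have hbij : Function.Bijective fun x ↦ x + t • g x := by
    constructor
    · intro x y hxy
      by_contra hne
      have h1 := hsm.dist_le_mul x y
      have h2 : dist (t • g x) (t • g y) = dist x y := by
        have h : t • g x - t • g y = -(x - y) := by
          have : x + t • g x = y + t • g y := hxy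
          rw [show t • g x = y + t • g y - x by rw [← this]; abel]
          abel
        rw [dist_eq_norm, h, norm_neg, dist_eq_norm]
      rw [h2] at h1
      have := dist_pos.2 hne
      have h3 : ((t.toNNReal * K : NNReal) : ℝ) < 1 := by exact_mod_cast hlt
      nlinarith
    · intro y
      have hc : ContractingWith (t.toNNReal * K) fun x ↦ y - t • g x :=
        ⟨hlt, LipschitzWith.of_dist_le_mul fun x z ↦ by
          rw [dist_sub_left]; exact hsm.dist_le_mul x z⟩
      refine ⟨hc.fixedPoint, ?_⟩
      have := hc.fixedPoint_isFixedPt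
      unfold Function.IsFixedPt at this
      beta_reduce at this ⊢
      nth_rw 1 [← this]
      abel
  have hin : ∀ x ∈ closedBall (0 : E) R, x + t • g x = x + t • u x := fun x hx ↦ by
    simp [hg, Set.indicator_of_mem hx]
  have hout : ∀ x ∉ closedBall (0 : E) R, x + t • g x = x := fun x hx ↦ by
    simp [hg, Set.indicator_of_notMem hx]
  refine ⟨fun x hx ↦ ?_, fun x hx y hy hxy ↦ ?_, fun y hy ↦ ?_⟩
  · by_contra hn
    have h : x + t • u x = x := hbij.1 ((hout _ hn).trans (hin x hx).symm)
    exact hn (by simpa only [h] using hx)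
  · apply hbij.1
    beta_reduce at hxy ⊢
    rw [hin x hx, hin y hy, hxy]
  · obtain ⟨x, hx⟩ := hbij.2 y
    have hxB : x ∈ closedBall (0 : E) R := by
      by_contra hn
      have h := hout x hn
      beta_reduce at hx
      exact hn (by rwa [← h, hx])
    exact ⟨x, hxB, by rw [← hx]; exact (hin x hxB).symm⟩

variable [MeasurableSpace E] [BorelSpace E]

/-- A `C¹` map fixing the sphere pointwise has nonzero Jacobian somewhere on the ball. -/
lemma exists_det_ne_zero_of_eq_on_sphere {u : E → E} (hu : ContDiff ℝ 1 u) {R : ℝ} (hR : 0 < R)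
    (h0 : ∀ x, ‖x‖ = R → u x = 0) :
    ∃ x, (ContinuousLinearMap.id ℝ E + fderiv ℝ u x).det ≠ 0 := by
  by_contra! hdet
  have hcpt : IsCompact (closedBall (0 : E) R) := isCompact_closedBall 0 R
  obtain ⟨K, hK⟩ := hu.contDiffOn.exists_lipschitzOnWith (s := closedBall (0 : E) R) one_ne_zero
    (convex_closedBall 0 R) hcpt
  have hfc : Continuous (fderiv ℝ u) := hu.continuous_fderiv one_ne_zero
  have hcont : Continuous fun q : ℝ × E ↦
      (ContinuousLinearMap.id ℝ E + q.1 • fderiv ℝ u q.2).det :=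
    ContinuousLinearMap.continuous_det.comp (by fun_prop)
  have hpos : ∀ᶠ t in nhds (0 : ℝ), ∀ x ∈ closedBall (0 : E) R,
      0 < (ContinuousLinearMap.id ℝ E + t • fderiv ℝ u x).det := by
    refine hcpt.eventually_forall_of_forall_eventually fun x _ ↦ ?_
    refine hcont.continuousAt.eventually (lt_mem_nhds ?_)
    simp [ContinuousLinearMap.det]
  obtain ⟨ε, hε, hpos⟩ := Metric.eventually_nhds_iff.1 hpos
  have hε' : 0 < min ε (1 / (K + 1)) := lt_min hε (by positivity)
  obtain ⟨s, w, hs, hw, hp⟩ := exists_interpolation_weights (finrank ℝ E) hε'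
  have hint : ∀ t ∈ s, IntegrableOn
        (fun x ↦ (ContinuousLinearMap.id ℝ E + t • fderiv ℝ u x).det) (closedBall 0 R) ∧
      ∫ x in closedBall 0 R, (ContinuousLinearMap.id ℝ E + t • fderiv ℝ u x).det =
        volume.real (closedBall (0 : E) R) := by
    intro t ht
    obtain ⟨ht0, htε⟩ := hs t ht
    have htK : t * K < 1 := by
      have := htε.trans_le (min_le_right _ _)
      rw [lt_div_iff₀ (by positivity)] at this
      nlinarith
    refine ⟨((hcont.comp (Continuous.prodMk_right t)).continuousOn).integrableOn_compact hcpt, ?_⟩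
    have hb := bijOn_closedBall_id_add_smul hK h0 ht0.le htK
    have hd : ∀ x ∈ closedBall (0 : E) R, HasFDerivWithinAt (fun x ↦ x + t • u x)
        (ContinuousLinearMap.id ℝ E + t • fderiv ℝ u x) (closedBall 0 R) x := fun x _ ↦
      ((hasFDerivAt_id x).add
        ((hu.differentiable one_ne_zero x).hasFDerivAt.const_smul t)).hasFDerivWithinAt
    have h := integral_image_eq_integral_abs_det_fderiv_smul volume measurableSet_closedBall hd
      hb.injOn (fun _ ↦ (1 : ℝ))
    rw [hb.image_eq] at h
    simp only [smul_eq_mul, mul_one, integral_const, MeasurableSet.univ, measureReal_restrict_apply,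
      Set.univ_inter] at h
    rw [h]
    refine setIntegral_congr_fun measurableSet_closedBall fun x hx ↦ ?_
    refine (abs_of_pos (hpos ?_ x hx)).symm
    rw [Real.dist_0_eq_abs, abs_of_pos ht0]
    exact htε.trans_le (min_le_left _ _)
  have hsum : ∀ x, ∑ t ∈ s, w t * (ContinuousLinearMap.id ℝ E + t • fderiv ℝ u x).det = 0 := by
    intro x
    obtain ⟨p, hdeg, hpe⟩ := exists_polynomial_det_one_add_smul (fderiv ℝ u x)
    have := hp p hdeg
    rw [← hpe 1, one_smul, hdet x] at this
    simp_rw [hpe]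
    exact this.symm
  have hzero : ∑ t ∈ s, w t * volume.real (closedBall (0 : E) R) = 0 := by
    calc _ = ∑ t ∈ s, ∫ x in closedBall 0 R,
          w t * (ContinuousLinearMap.id ℝ E + t • fderiv ℝ u x).det := by
          refine sum_congr rfl fun t ht ↦ ?_
          rw [integral_const_mul, (hint t ht).2]
      _ = 0 := by
          rw [← integral_finsetSum _ fun t ht ↦ (hint t ht).1.const_mul _]
          simp [hsum]
  rw [← Finset.sum_mul, hw, one_mul] at hzero
  refine (ENNReal.toReal_pos ?_ ?_).ne' hzero
  · exact (measure_closedBall_pos volume 0 hR).ne'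
  · exact hcpt.measure_lt_top.ne

/-- A continuous self-map at bounded distance from the identity has a zero. -/
lemma exists_eq_zero_of_norm_sub_le {h : E → E} (hc : Continuous h) {C : ℝ}
    (hC : ∀ x, ‖h x - x‖ ≤ C) : ∃ x, h x = 0 := by
  by_contra! hne
  have hC0 : 0 ≤ C := (norm_nonneg _).trans (hC 0)
  obtain ⟨δ, hδ, hδh⟩ := (isCompact_closedBall (0 : E) (C + 1)).exists_forall_le'
    hc.norm.continuousOn (a := 0) fun x _ ↦ norm_pos_iff.2 (hne x)
  obtain ⟨g, hg, hgh, -⟩ := hc.exists_contDiff_approx 1 (continuous_const (y := min δ 1))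
    fun _ ↦ lt_min hδ one_pos
  have hgne : ∀ x, g x ≠ 0 := by
    intro x hx
    have h1 : ‖h x‖ < min δ 1 := by simpa [hx] using hgh x
    by_cases hxC : ‖x‖ ≤ C + 1
    · exact absurd (hδh x (by simpa using hxC)) (not_le.2 (h1.trans_le (min_le_left _ _)))
    · have h2 := norm_sub_norm_le x (h x)
      rw [norm_sub_rev] at h2
      linarith [hC x, h1.trans_le (min_le_right δ 1)]
  have hgC : ∀ x, ‖g x - x‖ ≤ C + 1 := by
    intro x
    have h1 := norm_sub_le_norm_sub_add_norm_sub (g x) (h x) x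
    have h2 := hgh x
    rw [dist_eq_norm] at h2
    linarith [hC x, h2.trans_le (min_le_right δ 1)]
  let χ : ContDiffBump (0 : E) := ⟨C + 2, C + 3, by linarith, by linarith⟩
  let F : E → E := fun x ↦ x + χ x • (g x - x)
  have hF : ContDiff ℝ 1 F := contDiff_id.add (χ.contDiff.smul (hg.sub contDiff_id))
  have hFne : ∀ x, F x ≠ 0 := by
    intro x hx
    by_cases hxC : ‖x‖ ≤ C + 2
    · have : χ x = 1 := χ.one_of_mem_closedBall (by simpa using hxC)
      apply hgne x
      simpa [F, this] using hx
    · have h1 : ‖χ x • (g x - x)‖ ≤ C + 1 := by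
        rw [norm_smul, Real.norm_of_nonneg χ.nonneg]
        exact (mul_le_of_le_one_left (norm_nonneg _) χ.le_one).trans (hgC x)
      rw [← neg_eq_of_add_eq_zero_right hx, norm_neg] at h1
      linarith
  let G : E → E := fun x ↦ ((C + 3) / ‖F x‖) • F x
  have hG : ContDiff ℝ 1 G :=
    (contDiff_const.div (hF.norm ℝ hFne) fun x ↦ norm_ne_zero_iff.2 (hFne x)).smul hF
  have hGn : ∀ x, ‖G x‖ = C + 3 := by
    intro x
    have := norm_ne_zero_iff.2 (hFne x)
    rw [norm_smul, Real.norm_of_nonneg (by positivity)]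
    field_simp
  obtain ⟨x, hx⟩ := exists_det_ne_zero_of_eq_on_sphere (hG.sub contDiff_id) (R := C + 3)
    (by linarith) (fun x hx ↦ by
      have h1 : χ x = 0 := χ.zero_of_le_dist (by simp [χ, hx])
      have : C + 3 ≠ 0 := by linarith
      simp [G, F, h1, hx, this])
  have hd : HasFDerivAt G (fderiv ℝ G x) x := (hG.differentiable one_ne_zero x).hasFDerivAt
  have hsub : fderiv ℝ (fun y ↦ G y - id y) x = fderiv ℝ G x - ContinuousLinearMap.id ℝ E :=
    (hd.sub (hasFDerivAt_id x)).fderiv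
  rw [hsub, add_sub_cancel] at hx
  obtain ⟨v, hv⟩ := (LinearMap.equivOfDetNeZero _ hx).surjective (G x)
  have hv' : fderiv ℝ G x v = G x := hv
  have h1 := hd.norm_sq
  simp only [hGn] at h1
  have h2 := congrArg (fun L ↦ L v) (h1.unique (hasFDerivAt_const _ x))
  simp [hv', hGn] at h2
  linarith

/-- A continuous map of the unit ball which is close to the identity has a zero. -/
lemma exists_eq_zero_of_norm_sub_le_half {h : E → E} (hc : ContinuousOn h (closedBall 0 1))
    (hh : ∀ x ∈ closedBall (0 : E) 1, ‖h x - x‖ ≤ 1 / 2) :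
    ∃ x ∈ closedBall (0 : E) 1, h x = 0 := by
  let p : E → E := fun x ↦ (max 1 ‖x‖)⁻¹ • x
  have hpos : ∀ x : E, 0 < max 1 ‖x‖ := fun x ↦ lt_max_of_lt_left one_pos
  have hp : ∀ x, p x ∈ closedBall (0 : E) 1 := by
    intro x
    rw [mem_closedBall_zero_iff, norm_smul, norm_inv, Real.norm_of_nonneg (hpos x).le,
      inv_mul_le_one₀ (hpos x)]
    exact le_max_right _ _
  have hpc : Continuous p := by
    refine Continuous.smul (Continuous.inv₀ (by fun_prop) fun x ↦ (hpos x).ne') continuous_id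
  obtain ⟨x, hx⟩ := exists_eq_zero_of_norm_sub_le (h := fun x ↦ h (p x) + (x - p x)) (C := 1 / 2)
    ((hc.comp_continuous hpc hp).add (continuous_id.sub hpc)) fun x ↦ by
      convert hh (p x) (hp x) using 2
      abel
  have h1 := hh (p x) (hp x)
  have h2 : ‖x‖ ≤ 1 / 2 := by
    have : h (p x) - p x = - x := by
      rw [eq_neg_iff_add_eq_zero, ← hx]; abel
    rwa [this, norm_neg] at h1
  have h3 : p x = x := by
    simp [p, max_eq_left (show ‖x‖ ≤ 1 by linarith)]
  refine ⟨x, by simpa using h2.trans (by norm_num), by simpa [h3] using hx⟩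

lemma map_zero_mem_interior_image_closedBall {f : E → E} (hf : ContinuousOn f (closedBall 0 1))
    (hinj : Set.InjOn f (closedBall 0 1)) : f 0 ∈ interior (f '' closedBall 0 1) := by
  by_contra hnot
  have hB : IsCompact (closedBall (0 : E) 1) := isCompact_closedBall 0 1
  have h0B : (0 : E) ∈ closedBall (0 : E) 1 := by simp
  have : CompactSpace (closedBall (0 : E) 1) := isCompact_iff_compactSpace.1 hB
  have he : Topology.IsClosedEmbedding ((closedBall (0 : E) 1).domRestrict f) :=
    hf.domRestrict.isClosedEmbedding hinj.injective
  obtain ⟨G, hG⟩ := ContinuousMap.exists_extension' he ⟨Subtype.val, continuous_subtype_val⟩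
  have hGf : ∀ x ∈ closedBall (0 : E) 1, G (f x) = x := fun x hx ↦ congrFun hG ⟨x, hx⟩
  obtain ⟨δ, hδ, hGδ⟩ := Metric.continuousAt_iff.1 (G.continuous.continuousAt (x := f 0)) (1 / 10)
    (by norm_num)
  rw [hGf 0 h0B] at hGδ
  have hcl : f 0 ∈ closure (f '' closedBall 0 1)ᶜ := by
    rwa [closure_compl]
  obtain ⟨c, hcK, hc⟩ := Metric.mem_closure_iff.1 hcl (δ / 2) (by positivity)
  have hGc : ∀ y, ‖y‖ ≤ δ / 2 → ‖G (y + c)‖ ≤ 1 / 10 := by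
    intro y hy
    have : dist (y + c) (f 0) < δ := by
      have h1 := dist_triangle (y + c) c (f 0)
      rw [dist_comm c, dist_eq_norm (y + c) c, add_sub_cancel_right] at h1
      linarith
    simpa using (hGδ this).le
  have hne : ∀ x ∈ closedBall (0 : E) 1, f x - c ≠ 0 := fun x hx h ↦
    hcK ⟨x, hx, sub_eq_zero.1 h⟩
  have hfc : ContinuousOn (fun x ↦ f x - c) (closedBall 0 1) := hf.sub continuousOn_const
  have hS : IsCompact ((fun x ↦ f x - c) '' closedBall 0 1 ∩ {y | δ / 2 ≤ ‖y‖}) :=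
    (hB.image_of_continuousOn hfc).inter_right (isClosed_le continuous_const continuous_norm)
  have hGcc : Continuous fun y ↦ G (y + c) := by fun_prop
  obtain ⟨η, hη, hηG⟩ := hS.exists_forall_le' hGcc.norm.continuousOn (a := 0) (by
    rintro _ ⟨⟨x, hx, rfl⟩, hxδ⟩
    rw [norm_pos_iff, sub_add_cancel, hGf x hx]
    rintro rfl
    rw [Set.mem_ofPred_eq, ← dist_eq_norm] at hxδ
    linarith)
  have hmin : 0 < min (η / 2) (1 / 20) := by positivity
  obtain ⟨P, hP, hPG, -⟩ := hGcc.exists_contDiff_approx 1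
    (continuous_const (y := min (η / 2) (1 / 20))) fun _ ↦ hmin
  have hnull : volume (P '' sphere 0 (δ / 2)) = 0 :=
    addHaar_image_eq_zero_of_differentiableOn_of_addHaar_eq_zero _
      (hP.differentiable one_ne_zero).differentiableOn
      (Measure.addHaar_sphere_of_ne_zero _ _ (by positivity))
  obtain ⟨b, hbP, hb⟩ : ∃ b ∈ (P '' sphere 0 (δ / 2))ᶜ, dist 0 b < min (η / 2) (1 / 20) := by
    refine Metric.mem_closure_iff.1 ?_ _ hmin
    rw [closure_compl, Measure.interior_eq_empty_of_null hnull]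
    simp
  have hQ : ∀ y, ‖P y - b - G (y + c)‖ < min η (1 / 10) := by
    intro y
    have h1 := hPG y
    rw [dist_eq_norm] at h1
    rw [dist_zero_left] at hb
    have h2 := norm_sub_le (P y - G (y + c)) b
    rw [show P y - b - G (y + c) = P y - G (y + c) - b by abel]
    have := min_le_left (η / 2) (1 / 20)
    have := min_le_right (η / 2) (1 / 20)
    rw [lt_min_iff]
    constructor <;> linarith
  let Φ : E → E := fun y ↦ max 1 (δ / 2 / ‖y‖) • y
  have hΦ1 : ∀ y, δ / 2 ≤ ‖y‖ → Φ y = y := by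
    intro y hy
    have : δ / 2 / ‖y‖ ≤ 1 := div_le_one_of_le₀ hy (norm_nonneg _)
    simp [Φ, max_eq_left this]
  have hΦ2 : ∀ y, y ≠ 0 → ‖y‖ < δ / 2 → ‖Φ y‖ = δ / 2 := by
    intro y h0 hy
    have h1 := norm_pos_iff.2 h0
    have : 1 ≤ δ / 2 / ‖y‖ := by rw [le_div_iff₀ h1]; linarith
    rw [norm_smul, max_eq_right this, Real.norm_of_nonneg (by positivity)]
    field_simp
  have hΦc : ContinuousOn Φ {0}ᶜ := by
    refine ContinuousOn.smul (continuousOn_const.sup ?_) continuousOn_id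
    exact continuousOn_const.div continuousOn_id.norm fun y hy ↦ norm_ne_zero_iff.2 hy
  obtain ⟨x, hx, hx0⟩ := exists_eq_zero_of_norm_sub_le_half
    (h := fun x ↦ P (Φ (f x - c)) - b)
    ((hP.continuous.comp_continuousOn (hΦc.comp hfc hne)).sub continuousOn_const) (by
      intro x hx
      have h1 := hQ (Φ (f x - c))
      have h1' := h1.trans_le (min_le_right _ _)
      by_cases hxδ : δ / 2 ≤ ‖f x - c‖
      · rw [hΦ1 _ hxδ, sub_add_cancel, hGf x hx] at h1'
        rw [hΦ1 _ hxδ]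
        linarith
      · have h2 := hGc (f x - c) (not_le.1 hxδ).le
        rw [sub_add_cancel, hGf x hx] at h2
        have h3 := hGc (Φ (f x - c)) (hΦ2 _ (hne x hx) (not_le.1 hxδ)).le
        have h4 := norm_sub_le (P (Φ (f x - c)) - b) x
        have h5 := norm_sub_norm_le (P (Φ (f x - c)) - b) (G (Φ (f x - c) + c))
        linarith)
  by_cases hxδ : δ / 2 ≤ ‖f x - c‖
  · have h1 := hηG (f x - c) ⟨⟨x, hx, rfl⟩, hxδ⟩
    have h2 := (hQ (f x - c)).trans_le (min_le_left _ _)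
    rw [hΦ1 _ hxδ] at hx0
    rw [hx0, zero_sub, norm_neg] at h2
    linarith
  · exact hbP ⟨Φ (f x - c), by simpa using hΦ2 _ (hne x hx) (not_le.1 hxδ), sub_eq_zero.1 hx0⟩

/-- **Invariance of domain**. -/
theorem isOpen_image_of_continuousOn_injOn {U : Set E} (hU : IsOpen U) {f : E → E}
    (hf : ContinuousOn f U) (hinj : Set.InjOn f U) : IsOpen (f '' U) := by
  rw [isOpen_iff_mem_nhds]
  rintro _ ⟨x, hx, rfl⟩
  obtain ⟨r, hr, hrU⟩ := Metric.nhds_basis_closedBall.mem_iff.1 (hU.mem_nhds hx)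
  let a : E → E := fun y ↦ x + r • y
  have ha : Set.MapsTo a (closedBall 0 1) U := fun y hy ↦ hrU (by
    rw [mem_closedBall_zero_iff] at hy
    simp only [a, mem_closedBall, dist_self_add_left, norm_smul, Real.norm_of_nonneg hr.le]
    nlinarith)
  have hai : Function.Injective a := fun y z h ↦ by
    simpa [a, hr.ne'] using h
  have := map_zero_mem_interior_image_closedBall (f := f ∘ a)
    (hf.comp (by fun_prop) ha) (hinj.comp hai.injOn ha)
  rw [mem_interior_iff_mem_nhds, Set.image_comp] at this
  refine Filter.mem_of_superset (by simpa [a] using this) (Set.image_mono ha.image_subset)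

/-- Invariance of domain for maps from Euclidean space to a manifold of the same dimension. -/
theorem isOpen_image_of_injOn_of_chartedSpace {M : Type*} [TopologicalSpace M] [ChartedSpace E M]
    {U : Set E} (hU : IsOpen U) {f : E → M} (hf : ContinuousOn f U) (hinj : Set.InjOn f U) :
    IsOpen (f '' U) := by
  rw [isOpen_iff_mem_nhds]
  rintro _ ⟨x, hx, rfl⟩
  let c := chartAt E (f x)
  have hV : IsOpen (U ∩ f ⁻¹' c.source) := hf.isOpen_inter_preimage hU c.open_source
  have hm : Set.MapsTo f (U ∩ f ⁻¹' c.source) c.source := fun y hy ↦ hy.2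
  have ho := isOpen_image_of_continuousOn_injOn hV
    (c.continuousOn.comp (hf.mono Set.inter_subset_left) hm)
    (c.injOn.comp (hinj.mono Set.inter_subset_left) hm)
  rw [Set.image_comp] at ho
  have ho' : IsOpen (f '' (U ∩ f ⁻¹' c.source)) :=
    (c.isOpen_image_iff_of_subset_source hm.image_subset).1 ho
  exact Filter.mem_of_superset (ho'.mem_nhds ⟨x, ⟨hx, mem_chart_source E (f x)⟩, rfl⟩)
    (Set.image_mono Set.inter_subset_left)

/-- Invariance of domain for maps from a manifold to Euclidean space of the same dimension. -/
theorem isOpen_image_of_injOn_chartedSpace {M : Type*} [TopologicalSpace M] [ChartedSpace E M]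
    {V : Set M} (hV : IsOpen V) {f : M → E} (hf : ContinuousOn f V) (hinj : Set.InjOn f V) :
    IsOpen (f '' V) := by
  rw [isOpen_iff_mem_nhds]
  rintro _ ⟨x, hx, rfl⟩
  let c := chartAt E x
  have hxc : x ∈ c.source := mem_chart_source E x
  have hW : IsOpen (c '' (c.source ∩ V)) := c.isOpen_image_source_inter hV
  have hm : Set.MapsTo c.symm (c '' (c.source ∩ V)) V := by
    rintro _ ⟨y, hy, rfl⟩
    rw [c.left_inv hy.1]
    exact hy.2
  have hsub : c '' (c.source ∩ V) ⊆ c.target := by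
    rintro _ ⟨y, hy, rfl⟩
    exact c.map_source hy.1
  have ho := isOpen_image_of_continuousOn_injOn hW (hf.comp (c.continuousOn_symm.mono hsub) hm)
    (hinj.comp (c.symm.injOn.mono hsub) hm)
  rw [Set.image_comp] at ho
  refine Filter.mem_of_superset (ho.mem_nhds ⟨x, ⟨c x, ⟨x, ⟨hxc, hx⟩, rfl⟩, c.left_inv hxc⟩, rfl⟩)
    (Set.image_mono hm.image_subset)

end Topology

section Realization

variable {N n : ℕ} {Δ : Finset (Finset (Fin N))}

/-- Points of the realization with supports in a common set of `n + 1` vertices are determined by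
any `n` of their coordinates. -/
lemma realize_ext_of_eqOn {x y : Fin N → ℝ} (hx : x ∈ realize Δ) (hy : y ∈ realize Δ)
    {R : Finset (Fin N)} {a : Fin N} (hxa : ∀ v ∉ R, v ≠ a → x v = 0)
    (hya : ∀ v ∉ R, v ≠ a → y v = 0) (hxy : ∀ v ∈ R, x v = y v) : x = y := by
  have hne : ∀ v, v ≠ a → x v = y v := by
    intro v hv
    by_cases hvR : v ∈ R
    · exact hxy v hvR
    · rw [hxa v hvR hv, hya v hvR hv]
  obtain ⟨-, -, -, -, hx1⟩ := hx
  obtain ⟨-, -, -, -, hy1⟩ := hy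
  rw [← Finset.add_sum_erase _ _ (mem_univ a)] at hx1 hy1
  have h : ∑ v ∈ univ.erase a, x v = ∑ v ∈ univ.erase a, y v :=
    sum_congr rfl fun v hv ↦ hne v (ne_of_mem_erase hv)
  funext v
  by_cases hv : v = a
  · subst hv; linarith
  · exact hne v hv

lemma isOpen_setOf_forall_pos (F : Finset (Fin N)) :
    IsOpen {x : realize Δ | ∀ v ∈ F, 0 < x.1 v} := by
  have : {x : realize Δ | ∀ v ∈ F, 0 < x.1 v} = ⋂ v ∈ F, {x : realize Δ | 0 < x.1 v} := by
    ext; simp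
  rw [this]
  exact isOpen_biInter_finset fun v _ ↦
    isOpen_lt continuous_const ((continuous_apply v).comp continuous_subtype_val)

/-- The barycenter of a nonempty face. -/
lemma barycenter_mem_realize {F : Finset (Fin N)} (hF : F ∈ Δ) (hne : F.Nonempty) :
    (fun v ↦ if v ∈ F then (#F : ℝ)⁻¹ else 0) ∈ realize Δ := by
  have : (#F : ℝ) ≠ 0 := by exact_mod_cast hne.card_ne_zero
  refine ⟨F, hF, fun v ↦ by beta_reduce; split_ifs <;> positivity, fun v hv ↦ ?_, ?_⟩
  · by_contra h; simp [h] at hv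
  · simp [Finset.sum_ite_mem, this]

lemma exists_pos_add_smul_mem {E : Type*} [NormedAddCommGroup E] [NormedSpace ℝ E] {O : Set E}
    (hO : IsOpen O) {y : E} (hy : y ∈ O) (w : E) : ∃ ε : ℝ, 0 < ε ∧ y + ε • w ∈ O := by
  have hc : Continuous fun ε : ℝ ↦ y + ε • w := by fun_prop
  have : (fun ε : ℝ ↦ y + ε • w) ⁻¹' O ∈ nhds 0 := (hO.preimage hc).mem_nhds (by simpa using hy)
  obtain ⟨r, hr, h⟩ := Metric.mem_nhds_iff.1 this
  exact ⟨r / 2, by positivity, h (by simp [abs_of_pos hr, hr])⟩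

/-- The face spanned by the support of a point of the realization. -/
lemma support_mem_of_mem_realize (h_down : ∀ F ∈ Δ, ∀ G ⊆ F, G ∈ Δ) {x : Fin N → ℝ}
    (hx : x ∈ realize Δ) : univ.filter (fun v ↦ x v ≠ 0) ∈ Δ := by
  obtain ⟨F, hF, -, h, -⟩ := hx
  exact h_down F hF _ fun v hv ↦ h v (by simpa using hv)

variable [ChartedSpace (EuclideanSpace ℝ (Fin n)) (realize Δ)]

/-- Projection to the coordinates in `R` is open on open sets of points supported on `R ∪ {a}`. -/
lemma isOpen_image_coordinates {R : Finset (Fin N)} (r : Fin n ≃ R) (a : Fin N)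
    {V : Set (realize Δ)} (hV : IsOpen V) (hVa : ∀ x ∈ V, ∀ v ∉ R, v ≠ a → x.1 v = 0) :
    IsOpen ((fun x : realize Δ ↦ WithLp.toLp 2 fun i ↦ x.1 (r i)) '' V) := by
  refine isOpen_image_of_injOn_chartedSpace hV (Continuous.continuousOn ?_) fun x hx y hy hxy ↦ ?_
  · exact (PiLp.continuous_toLp 2 _).comp
      (continuous_pi fun i ↦ (continuous_apply _).comp continuous_subtype_val)
  · refine Subtype.ext (realize_ext_of_eqOn x.2 y.2 (hVa x hx) (hVa y hy) fun v hv ↦ ?_)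
    simpa using congrFun (congrArg WithLp.ofLp hxy) (r.symm ⟨v, hv⟩)

/-- A triangulated `n`-manifold is pure: small faces are not maximal. -/
lemma exists_insert_mem_of_card_le (h_down : ∀ F ∈ Δ, ∀ G ⊆ F, G ∈ Δ) (hN : n < N)
    {F : Finset (Fin N)} (hF : F ∈ Δ) (hne : F.Nonempty) (hcard : #F ≤ n) :
    ∃ x ∉ F, insert x F ∈ Δ := by
  by_contra! hmax
  obtain ⟨v₀, hv₀⟩ := hne
  have hlt : #(F.erase v₀) < #F := card_erase_lt_of_mem hv₀
  obtain ⟨R, hFR, hRv, hR⟩ := Finset.exists_subsuperset_card_eq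
    (Finset.erase_subset_erase v₀ (subset_univ F)) (hlt.le.trans hcard) (by
      rw [card_erase_of_mem (mem_univ _), card_univ, Fintype.card_fin]; omega)
  obtain ⟨a, haR, haF⟩ : ∃ a ∈ R, a ∉ F.erase v₀ :=
    Finset.exists_mem_notMem_of_card_lt_card (by omega)
  have haF' : a ∉ F := fun h ↦ haF (mem_erase.2 ⟨ne_of_mem_erase (hRv haR), h⟩)
  let r : Fin n ≃ R := (Finset.equivFinOfCardEq hR).symm
  have hsupp : ∀ x ∈ {x : realize Δ | ∀ v ∈ F, 0 < x.1 v}, ∀ v ∉ F, x.1 v = 0 := by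
    intro x hx v hv
    by_contra h
    refine hmax v hv (h_down _ (support_mem_of_mem_realize h_down x.2) _ ?_)
    intro w hw
    rcases mem_insert.1 hw with rfl | hw
    · simpa using h
    · simpa using (hx w hw).ne'
  have ho := isOpen_image_coordinates (Δ := Δ) r v₀ (isOpen_setOf_forall_pos F) fun x hx v hv hv' ↦
    hsupp x hx v fun h ↦ hv (hFR (mem_erase.2 ⟨hv', h⟩))
  have hmem : (⟨_, barycenter_mem_realize hF ⟨v₀, hv₀⟩⟩ : realize Δ) ∈
      {x : realize Δ | ∀ v ∈ F, 0 < x.1 v} := by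
    intro v hv
    have : 0 < #F := card_pos.2 ⟨v, hv⟩
    simp only [hv, if_true]
    positivity
  obtain ⟨ε, hε, y, hy, hye⟩ := exists_pos_add_smul_mem ho ⟨_, hmem, rfl⟩
    (EuclideanSpace.single (r.symm ⟨a, haR⟩) (1 : ℝ))
  have h := congrFun (congrArg WithLp.ofLp hye) (r.symm ⟨a, haR⟩)
  simp [haF', hsupp y hy a haF'] at h
  exact hε.ne h

/-- A triangulated `n`-manifold has no free faces of codimension one. -/
lemma exists_insert_mem_ne (h_down : ∀ F ∈ Δ, ∀ G ⊆ F, G ∈ Δ) (hn : 0 < n)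
    {R : Finset (Fin N)} (hRΔ : R ∈ Δ) (hR : #R = n) (a : Fin N) :
    ∃ x ∉ R, x ≠ a ∧ insert x R ∈ Δ := by
  by_contra! hmax
  have hne : R.Nonempty := card_pos.1 (by omega)
  let r : Fin n ≃ R := (Finset.equivFinOfCardEq hR).symm
  have hsupp : ∀ x ∈ {x : realize Δ | ∀ v ∈ R, 0 < x.1 v}, ∀ v ∉ R, v ≠ a → x.1 v = 0 := by
    intro x hx v hv hva
    by_contra h
    refine hmax v hv hva (h_down _ (support_mem_of_mem_realize h_down x.2) _ ?_)
    intro w hw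
    rcases mem_insert.1 hw with rfl | hw
    · simpa using h
    · simpa using (hx w hw).ne'
  have ho := isOpen_image_coordinates (Δ := Δ) r a (isOpen_setOf_forall_pos R) hsupp
  have hmem : (⟨_, barycenter_mem_realize hRΔ hne⟩ : realize Δ) ∈
      {x : realize Δ | ∀ v ∈ R, 0 < x.1 v} := by
    intro v hv
    have : 0 < #R := card_pos.2 ⟨v, hv⟩
    simp only [hv, if_true]
    positivity
  obtain ⟨ε, hε, y, hy, hye⟩ := exists_pos_add_smul_mem ho ⟨_, hmem, rfl⟩
    (WithLp.toLp 2 fun _ ↦ (1 : ℝ))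
  have h : ∑ i, y.1 (r i) = 1 + n * ε := by
    have h' : ∀ i, y.1 (r i) = (n : ℝ)⁻¹ + ε := fun i ↦ by
      simpa [hR] using congrFun (congrArg WithLp.ofLp hye) i
    have : (n : ℝ) ≠ 0 := by positivity
    simp [h', this]
  have hle : ∑ i, y.1 (r i) ≤ 1 := by
    obtain ⟨-, -, hpos, -, h1⟩ := y.2
    rw [← h1, Equiv.sum_comp r fun v : R ↦ y.1 v, sum_coe_sort R y.1]
    exact sum_le_univ_sum_of_nonneg hpos
  have : 0 < n * ε := by positivity
  linarith

/-- In a triangulated `n`-manifold a face of codimension one lies in at most two facets. -/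
lemma not_three_insert_mem (hn : 0 < n) {R : Finset (Fin N)} (hR : #R = n) {a b c : Fin N}
    (ha : a ∉ R) (hb : b ∉ R) (hc : c ∉ R) (hab : a ≠ b) (hac : a ≠ c) (hbc : b ≠ c)
    (haΔ : insert a R ∈ Δ) (hbΔ : insert b R ∈ Δ) (hcΔ : insert c R ∈ Δ) : False := by
  let r : Fin n ≃ R := (Finset.equivFinOfCardEq hR).symm
  have hra : ∀ i, (r i : Fin N) ≠ a := fun i h ↦ ha (h ▸ (r i).2)
  have hrb : ∀ i, (r i : Fin N) ≠ b := fun i h ↦ hb (h ▸ (r i).2)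
  have hrc : ∀ i, (r i : Fin N) ≠ c := fun i h ↦ hc (h ▸ (r i).2)
  let s : EuclideanSpace ℝ (Fin n) → ℝ := fun y ↦ ∑ i, |y i|
  let z : EuclideanSpace ℝ (Fin n) → Fin N → ℝ := fun y v ↦
    (∑ i, if (r i : Fin N) = v then |y i| else 0) + (if v = a then max 0 (1 - s y) else 0) +
      (if v = b then max 0 (s y - 1) else 0)
  let T : EuclideanSpace ℝ (Fin n) → ℝ := fun y ↦ s y + max 0 (1 - s y) + max 0 (s y - 1)
  have hs : ∀ y, 0 ≤ s y := fun y ↦ sum_nonneg fun i _ ↦ abs_nonneg _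
  have hT : ∀ y, 0 < T y := by
    intro y
    have h1 := le_max_right 0 (1 - s y)
    have h2 := le_max_left 0 (s y - 1)
    simp only [T]
    linarith
  have hz0 : ∀ y v, 0 ≤ z y v := by
    intro y v
    refine add_nonneg (add_nonneg (sum_nonneg fun i _ ↦ ?_) ?_) ?_ <;> split_ifs <;> positivity
  have hzsum : ∀ y, ∑ v, z y v = T y := by
    intro y
    simp only [z, sum_add_distrib]
    rw [sum_comm]
    simp [T, s]
  have hzr : ∀ y i, z y (r i) = |y i| := by
    intro y i
    simp [z, hra, hrb]
  have hza : ∀ y, z y a = max 0 (1 - s y) := by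
    intro y
    simp [z, hra, hab]
  have hzb : ∀ y, z y b = max 0 (s y - 1) := by
    intro y
    simp [z, hrb, hab.symm]
  have hzc : ∀ y, z y c = 0 := by
    intro y
    simp [z, hrc, hac.symm, hbc.symm]
  have hz' : ∀ y v, v ∉ R → v ≠ a → v ≠ b → z y v = 0 := by
    intro y v hv hva hvb
    have : ∀ i, (r i : Fin N) ≠ v := fun i h ↦ hv (h ▸ (r i).2)
    simp [z, this, hva, hvb]
  have hmem : ∀ y, (fun v ↦ z y v / T y) ∈ realize Δ := by
    intro y
    have h0 : ∀ v, 0 ≤ z y v / T y := fun v ↦ div_nonneg (hz0 y v) (hT y).le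
    have h1 : ∑ v, z y v / T y = 1 := by
      rw [← sum_div, hzsum, div_self (hT y).ne']
    rcases le_total (s y) 1 with h | h
    · refine ⟨insert a R, haΔ, h0, fun v hv ↦ ?_, h1⟩
      by_contra hvR
      rw [mem_insert, not_or] at hvR
      refine hv (show z y v / T y = 0 from ?_)
      by_cases hvb : v = b
      · rw [hvb, hzb, max_eq_left (by linarith), zero_div]
      · rw [hz' y v hvR.2 hvR.1 hvb, zero_div]
    · refine ⟨insert b R, hbΔ, h0, fun v hv ↦ ?_, h1⟩
      by_contra hvR
      rw [mem_insert, not_or] at hvR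
      refine hv (show z y v / T y = 0 from ?_)
      by_cases hva : v = a
      · rw [hva, hza, max_eq_left (by linarith), zero_div]
      · rw [hz' y v hvR.2 hva hvR.1, zero_div]
  let φ : EuclideanSpace ℝ (Fin n) → realize Δ := fun y ↦ ⟨_, hmem y⟩
  have hsc : Continuous s := by fun_prop
  have hφ : Continuous φ := by
    refine Continuous.subtype_mk (continuous_pi fun v ↦ Continuous.div ?_ ?_ fun y ↦ (hT y).ne') _
    · refine ((continuous_finsetSum _ fun i _ ↦ ?_).add ?_).add ?_ <;> split_ifs <;> fun_prop
    · fun_prop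
  have hU : IsOpen {y : EuclideanSpace ℝ (Fin n) | ∀ i, 0 < y i} := by
    simp only [Set.ofPred_forall]
    exact isOpen_iInter_of_finite fun i ↦ isOpen_lt continuous_const (by fun_prop)
  have hinj : Set.InjOn φ {y : EuclideanSpace ℝ (Fin n) | ∀ i, 0 < y i} := by
    intro y hy y' hy' h
    have hv : ∀ v, z y v / T y = z y' v / T y' := fun v ↦ congrFun (congrArg Subtype.val h) v
    have h1 := hv a
    have h2 := hv b
    have h3 : s y / T y = s y' / T y' := by
      have : ∀ y, s y / T y = ∑ i, z y (r i) / T y := fun y ↦ by simp [hzr, s, sum_div]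
      rw [this, this]
      exact sum_congr rfl fun i _ ↦ hv (r i)
    have hmm : ∀ y, (1 : ℝ) / T y = z y a / T y - z y b / T y + s y / T y := by
      intro y
      rw [hza, hzb, ← sub_div, ← add_div]
      congr 1
      rcases le_total (s y) 1 with h | h
      · rw [max_eq_right (by linarith), max_eq_left (by linarith)]; ring
      · rw [max_eq_left (by linarith), max_eq_right (by linarith)]; ring
    have hTT : T y = T y' := by
      have : (1 : ℝ) / T y = 1 / T y' := by rw [hmm, hmm, h1, h2, h3]
      simpa using this
    ext i
    have h4 := hv (r i)
    rw [hTT, div_left_inj' (hT y').ne', hzr, hzr, abs_of_pos (hy i), abs_of_pos (hy' i)] at h4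
    exact h4
  obtain ⟨W, hW, hWO⟩ := isOpen_induced_iff.1
    (isOpen_image_of_injOn_of_chartedSpace hU hφ.continuousOn hinj)
  let y₀ : EuclideanSpace ℝ (Fin n) := WithLp.toLp 2 fun _ ↦ (n : ℝ)⁻¹
  have hn' : (n : ℝ) ≠ 0 := by positivity
  have hy₀ : y₀ ∈ {y : EuclideanSpace ℝ (Fin n) | ∀ i, 0 < y i} := fun i ↦ by
    simp only [y₀]; positivity
  have hβ : (φ y₀).1 ∈ W := by
    have : φ y₀ ∈ Subtype.val ⁻¹' W := hWO ▸ ⟨y₀, hy₀, rfl⟩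
    exact this
  have hs₀ : s y₀ = 1 := by simp [s, y₀, hn']
  have hsupp₀ : ∀ v ∉ R, (φ y₀).1 v = 0 := by
    intro v hv
    show z y₀ v / T y₀ = 0
    by_cases hva : v = a
    · simp [hva, hza, hs₀]
    · by_cases hvb : v = b
      · simp [hvb, hzb, hs₀]
      · simp [hz' y₀ v hv hva hvb]
  obtain ⟨-, -, hp0, -, hp1⟩ := (φ y₀).2
  let q : ℝ → Fin N → ℝ := fun ε v ↦ (1 - ε) * (φ y₀).1 v + ε * (if v = c then 1 else 0)
  have hqc : Continuous q := by fun_prop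
  have hq0 : q ⁻¹' W ∈ nhds 0 := (hW.preimage hqc).mem_nhds (by simpa [q] using hβ)
  obtain ⟨ρ, hρ, hball⟩ := Metric.mem_nhds_iff.1 hq0
  set ε := min (ρ / 2) 1 with hε
  have hε0 : 0 < ε := by positivity
  have hε1 : ε ≤ 1 := min_le_right _ _
  have hεW : q ε ∈ W := hball (by
    rw [Metric.mem_ball, Real.dist_0_eq_abs, abs_of_pos hε0]
    linarith [min_le_left (ρ / 2) 1])
  have hqX : q ε ∈ realize Δ := by
    refine ⟨insert c R, hcΔ, fun v ↦ ?_, fun v hv ↦ ?_, ?_⟩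
    · have := mul_nonneg (sub_nonneg.2 hε1) (hp0 v)
      simp only [q]
      split_ifs <;> linarith
    · by_contra hvR
      rw [mem_insert, not_or] at hvR
      simp [q, hvR.1, hsupp₀ v hvR.2] at hv
    · simp only [q, sum_add_distrib, ← mul_sum, hp1]
      simp
  have : (⟨q ε, hqX⟩ : realize Δ) ∈ φ '' {y | ∀ i, 0 < y i} := hWO ▸ hεW
  obtain ⟨y, -, hy⟩ := this
  have h := congrFun (congrArg Subtype.val hy) c
  have h' : z y c / T y = q ε c := h
  rw [hzc, zero_div] at h'
  simp [q, hsupp₀ c hc] at h'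
  exact hε0.ne h'

end Realization

section Combinatorics

open scoped Classical

variable {V : Type*} {H : SimpleGraph V} {S F : Finset V} {v w : V} {d : ℕ}

/-- The faces of the flag complex with vertex set `S` whose missing edges are those of `H`: the
subsets of `S` containing no edge of `H`. -/
noncomputable def indepFaces (H : SimpleGraph V) (S : Finset V) : Finset (Finset V) :=
  S.powerset.filter fun F ↦ ∀ a ∈ F, ∀ b ∈ F, ¬ H.Adj a b

/-- The vertex set of the link of `v`. -/
noncomputable def indepLink (H : SimpleGraph V) (S : Finset V) (v : V) : Finset V :=
  S.filter fun x ↦ x ≠ v ∧ ¬ H.Adj v x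

lemma mem_indepFaces : F ∈ indepFaces H S ↔ F ⊆ S ∧ ∀ a ∈ F, ∀ b ∈ F, ¬ H.Adj a b := by
  simp [indepFaces]

lemma mem_indepLink {x : V} : x ∈ indepLink H S v ↔ x ∈ S ∧ x ≠ v ∧ ¬ H.Adj v x := by
  simp [indepLink]

lemma indepFaces_mono {T : Finset V} (hST : S ⊆ T) : indepFaces H S ⊆ indepFaces H T :=
  fun _ hF ↦ mem_indepFaces.2 ⟨(mem_indepFaces.1 hF).1.trans hST, (mem_indepFaces.1 hF).2⟩

lemma indepLink_subset : indepLink H S v ⊆ S := filter_subset _ _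

lemma empty_mem_indepFaces : ∅ ∈ indepFaces H S := by simp [mem_indepFaces]

lemma notMem_of_mem_indepFaces_indepLink (hF : F ∈ indepFaces H (indepLink H S v)) : v ∉ F :=
  fun h ↦ (mem_indepLink.1 ((mem_indepFaces.1 hF).1 h)).2.1 rfl

variable [DecidableEq V]

/-- The flag complex `indepFaces H S` is pure of dimension `d - 1` and each of its faces of
codimension one lies in exactly two facets. -/
structure IsFlagPseudomanifold (H : SimpleGraph V) (S : Finset V) (d : ℕ) : Prop where
  card_le : ∀ F ∈ indepFaces H S, #F ≤ d
  exists_insert : ∀ F ∈ indepFaces H S, #F < d → ∃ x ∉ F, insert x F ∈ indepFaces H S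
  card_ridge : ∀ F ∈ indepFaces H S, #F + 1 = d →
    #(S.filter fun x ↦ x ∉ F ∧ insert x F ∈ indepFaces H S) = 2

lemma insert_mem_indepFaces (hv : v ∉ F) :
    insert v F ∈ indepFaces H S ↔ v ∈ S ∧ F ∈ indepFaces H (indepLink H S v) := by
  simp only [mem_indepFaces, forall_mem_insert, subset_iff, mem_indepLink]
  constructor
  · rintro ⟨⟨h1, h2⟩, ⟨h3, h4⟩, h5⟩
    exact ⟨h1, fun x hx ↦ ⟨h2 x hx, fun h ↦ hv (h ▸ hx), h4 x hx⟩, fun a ha ↦ (h5 a ha).2⟩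
  · rintro ⟨h1, h2, h3⟩
    exact ⟨⟨h1, fun x hx ↦ (h2 hx).1⟩, ⟨H.irrefl, fun x hx ↦ (h2 hx).2.2⟩,
      fun a ha ↦ ⟨fun h ↦ (h2 ha).2.2 h.symm, h3 a ha⟩⟩

lemma card_indepLink (hv : v ∈ S) : #(indepLink H S v) + 1 + #(S.filter (H.Adj v)) = #S := by
  have h1 : S.filter (fun x ↦ ¬ H.Adj v x) = insert v (indepLink H S v) := by
    ext x
    simp only [mem_filter, mem_insert, mem_indepLink]
    by_cases h : x = v
    · simp [h, hv]
    · simp [h]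
  have h2 := card_filter_add_card_filter_not (s := S) (H.Adj v)
  rw [h1, card_insert_of_notMem (by simp [mem_indepLink])] at h2
  omega

/-- Splitting the faces into those avoiding `v` and those containing `v`. -/
lemma sum_indepFaces {M : Type*} [AddCommMonoid M] (g : ℕ → M) (hv : v ∈ S) :
    ∑ F ∈ indepFaces H S, g #F =
      ∑ F ∈ indepFaces H (S.erase v), g #F + ∑ F ∈ indepFaces H (indepLink H S v), g (#F + 1) := by
  rw [← sum_filter_add_sum_filter_not (indepFaces H S) (fun F ↦ v ∉ F)]
  congr 1
  · refine sum_congr ?_ fun _ _ ↦ rfl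
    ext F
    simp only [mem_filter, mem_indepFaces, subset_erase]
    tauto
  · refine (sum_bij' (fun F _ ↦ insert v F) (fun F _ ↦ F.erase v) ?_ ?_ ?_ ?_ ?_).symm
    · intro F hF
      have := notMem_of_mem_indepFaces_indepLink hF
      simp [insert_mem_indepFaces this, hv, hF]
    · intro F hF
      simp only [mem_filter, not_not] at hF
      rw [← insert_erase hF.2, insert_mem_indepFaces (notMem_erase v F)] at hF
      exact hF.1.2
    · intro F hF
      exact erase_insert (notMem_of_mem_indepFaces_indepLink hF)
    · intro F hF
      exact insert_erase (by simpa using (mem_filter.1 hF).2)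
    · intro F hF
      rw [card_insert_of_notMem (notMem_of_mem_indepFaces_indepLink hF)]

namespace IsFlagPseudomanifold

lemma link (h : IsFlagPseudomanifold H S (d + 1)) (hv : v ∈ S) :
    IsFlagPseudomanifold H (indepLink H S v) d := by
  have key : ∀ F ∈ indepFaces H (indepLink H S v),
      insert v F ∈ indepFaces H S ∧ #(insert v F) = #F + 1 := fun F hF ↦ by
    have := notMem_of_mem_indepFaces_indepLink hF
    exact ⟨(insert_mem_indepFaces this).2 ⟨hv, hF⟩, card_insert_of_notMem this⟩
  have key' : ∀ F ∈ indepFaces H (indepLink H S v), ∀ x,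
      (x ∉ insert v F ∧ insert x (insert v F) ∈ indepFaces H S ↔
        x ∉ F ∧ insert x F ∈ indepFaces H (indepLink H S v)) := fun F hF x ↦ by
    have hvF := notMem_of_mem_indepFaces_indepLink hF
    by_cases hx : x = v
    · subst hx
      simp only [mem_insert_self, not_true, false_and, false_iff, not_and]
      exact fun _ h ↦ notMem_of_mem_indepFaces_indepLink h (mem_insert_self _ _)
    · rw [insert_comm, insert_mem_indepFaces (by simp [hvF, Ne.symm hx])]
      simp [hx, hv]
  refine ⟨fun F hF ↦ ?_, fun F hF hlt ↦ ?_, fun F hF hc ↦ ?_⟩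
  · have := h.card_le _ (key F hF).1
    have := (key F hF).2
    omega
  · obtain ⟨x, hx⟩ := h.exists_insert _ (key F hF).1 (by rw [(key F hF).2]; omega)
    exact ⟨x, (key' F hF x).1 hx⟩
  · rw [← h.card_ridge _ (key F hF).1 (by rw [(key F hF).2]; omega)]
    congr 1
    ext x
    simp only [mem_filter, key' F hF x]
    refine ⟨fun hx ↦ ⟨indepLink_subset hx.1, hx.2⟩, fun hx ↦ ⟨?_, hx.2⟩⟩
    exact (mem_indepFaces.1 hx.2.2).1 (mem_insert_self _ _)

lemma exists_facet (h : IsFlagPseudomanifold H S d) (hF : F ∈ indepFaces H S) :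
    ∃ G ∈ indepFaces H S, F ⊆ G ∧ #G = d := by
  induction hk : d - #F generalizing F with
  | zero => exact ⟨F, hF, subset_rfl, le_antisymm (h.card_le F hF) (by omega)⟩
  | succ k ih =>
    obtain ⟨x, hx, hxF⟩ := h.exists_insert F hF (by omega)
    obtain ⟨G, hG, hFG, hGd⟩ := ih hxF (by rw [card_insert_of_notMem hx]; omega)
    exact ⟨G, hG, (subset_insert x F).trans hFG, hGd⟩

/-- No vertex is a cone point. -/
lemma exists_adj (h : IsFlagPseudomanifold H S d) (hv : v ∈ S) : ∃ w ∈ S, H.Adj v w := by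
  by_contra! hno
  obtain ⟨G, hG, hvG, hGd⟩ := h.exists_facet (F := {v}) (by simp [mem_indepFaces, hv])
  rw [singleton_subset_iff] at hvG
  have hG' := hG
  rw [← insert_erase hvG, insert_mem_indepFaces (notMem_erase v G)] at hG'
  have hR := indepFaces_mono indepLink_subset hG'.2
  obtain ⟨x, hx, hxv⟩ := exists_mem_ne (by
    rw [h.card_ridge _ hR (by rw [card_erase_of_mem hvG, ← hGd]
                              exact Nat.sub_add_cancel (card_pos.2 ⟨v, hvG⟩))]; norm_num) v
  obtain ⟨hxS, hxR, hxF⟩ := mem_filter.1 hx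
  have hxG : x ∉ G := fun hxG ↦ hxR (mem_erase.2 ⟨hxv, hxG⟩)
  have hbig : insert x G ∈ indepFaces H S := by
    rw [← insert_erase hvG, insert_comm, insert_mem_indepFaces (by simp [hxv.symm])]
    refine ⟨hv, mem_indepFaces.2 ⟨fun y hy ↦ ?_, (mem_indepFaces.1 hxF).2⟩⟩
    have hyS := (mem_indepFaces.1 hxF).1 hy
    refine mem_indepLink.2 ⟨hyS, ?_, hno y hyS⟩
    rintro rfl
    simp [hxv.symm] at hy
  have := h.card_le _ hbig
  rw [card_insert_of_notMem hxG] at this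
  omega

lemma one_le_card_adj (h : IsFlagPseudomanifold H S d) (hv : v ∈ S) :
    1 ≤ #(S.filter (H.Adj v)) := by
  obtain ⟨w, hw, hvw⟩ := h.exists_adj hv
  exact card_pos.2 ⟨w, mem_filter.2 ⟨hw, hvw⟩⟩

lemma two_mul_le_card (h : IsFlagPseudomanifold H S d) : 2 * d ≤ #S := by
  induction d generalizing S with
  | zero => simp
  | succ d ih =>
    obtain ⟨v, -, hv⟩ := h.exists_insert ∅ empty_mem_indepFaces (by simp)
    have hvS := (mem_indepFaces.1 hv).1 (mem_insert_self v ∅)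
    have := ih (h.link hvS)
    have := card_indepLink (H := H) hvS
    have := h.one_le_card_adj hvS
    omega

/-- The complex is a suspension over any pair of vertices one of which has a unique non-neighbour. -/
lemma adj_eq_of_filter_adj_eq (h : IsFlagPseudomanifold H S (d + 1)) (hv : v ∈ S)
    (hvw : S.filter (H.Adj v) = {w}) : S.filter (H.Adj w) = {v} := by
  have hw : w ∈ S.filter (H.Adj v) := hvw ▸ mem_singleton_self w
  rw [mem_filter] at hw
  refine eq_singleton_iff_unique_mem.2 ⟨mem_filter.2 ⟨hv, hw.2.symm⟩, fun x hx ↦ ?_⟩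
  rw [mem_filter] at hx
  by_contra hxv
  have hvx : ¬ H.Adj v x := fun hvx ↦ by
    have : x ∈ S.filter (H.Adj v) := mem_filter.2 ⟨hx.1, hvx⟩
    rw [hvw, mem_singleton] at this
    exact hx.2.ne this.symm
  obtain ⟨y, hy, hvy⟩ := (h.link hx.1).exists_adj (v := v)
    (mem_indepLink.2 ⟨hv, Ne.symm hxv, fun h ↦ hvx h.symm⟩)
  rw [mem_indepLink] at hy
  have : y ∈ S.filter (H.Adj v) := mem_filter.2 ⟨hy.1, hvy⟩
  rw [hvw, mem_singleton] at this
  exact hy.2.2 (this ▸ hx.2.symm)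

end IsFlagPseudomanifold

end Combinatorics

section GammaOne

open scoped Classical

variable {N : ℕ} {H : SimpleGraph (Fin N)} {S : Finset (Fin N)} {v w : Fin N} {d : ℕ}

namespace IsFlagPseudomanifold

/-- The `h`-polynomial of a suspension. -/
lemma hPoly_succ (h : IsFlagPseudomanifold H S (d + 1)) (hv : v ∈ S)
    (hvw : S.filter (H.Adj v) = {w}) :
    hPoly (d + 1) (indepFaces H S) = (1 + X) * hPoly d (indepFaces H (indepLink H S v)) := by
  have hwv := h.adj_eq_of_filter_adj_eq hv hvw
  have hw : w ∈ S.filter (H.Adj v) := hvw ▸ mem_singleton_self w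
  rw [mem_filter] at hw
  have hadj : ∀ x ∈ S, (H.Adj v x ↔ x = w) := fun x hx ↦ by
    simpa [hx] using Finset.ext_iff.1 hvw x
  have hadj' : ∀ x ∈ S, (H.Adj w x ↔ x = v) := fun x hx ↦ by
    simpa [hx] using Finset.ext_iff.1 hwv x
  have h1 : (S.erase v).erase w = indepLink H S v := by
    ext x
    simp only [mem_erase, mem_indepLink]
    have := hadj x
    tauto
  have h2 : indepLink H (S.erase v) w = indepLink H S v := by
    ext x
    simp only [mem_erase, mem_indepLink]
    have := hadj x
    have := hadj' x
    tauto
  unfold hPoly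
  rw [sum_indepFaces (fun k ↦ X ^ k * (1 - X) ^ (d + 1 - k)) hv,
    sum_indepFaces (fun k ↦ X ^ k * (1 - X) ^ (d + 1 - k)) (mem_erase.2 ⟨hw.2.ne', hw.1⟩),
    h1, h2, ← sum_add_distrib, ← sum_add_distrib, mul_sum]
  refine sum_congr rfl fun F hF ↦ ?_
  have hle := (h.link hv).card_le F hF
  rw [Nat.add_sub_add_right, Nat.sub_add_comm hle]
  ring

/-- A pentagon. -/
lemma hPoly_two (h : IsFlagPseudomanifold H S 2) (hS : #S = 5) :
    hPoly 2 (indepFaces H S) = (1 + X) ^ 2 + X := by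
  have hcount : #((indepFaces H S).filter (#· = 2)) = 5 := by
    have := card_mul_eq_card_mul (s := S) (t := (indepFaces H S).filter (#· = 2))
      (fun v F ↦ v ∈ F) (m := 2) (n := 2) ?_ ?_
    · omega
    · intro v hv
      refine Eq.trans ?_ (h.card_ridge {v} (by simp [mem_indepFaces, hv]) (by simp))
      refine (card_bij (fun x _ ↦ insert x {v}) ?_ ?_ ?_).symm
      · intro x hx
        simp only [mem_filter] at hx
        simp [mem_bipartiteAbove, hx.2.2, card_insert_of_notMem hx.2.1]
      · intro x hx y hy hxy
        have : x ∈ insert y {v} := hxy ▸ mem_insert_self x {v}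
        rcases mem_insert.1 this with h | h
        · exact h
        · exact absurd h (mem_filter.1 hx).2.1
      · intro F hF
        simp only [mem_bipartiteAbove, mem_filter] at hF
        obtain ⟨⟨hF, hF2⟩, hvF⟩ := hF
        obtain ⟨x, hx⟩ := card_eq_one.1 (show #(F.erase v) = 1 by rw [card_erase_of_mem hvF, hF2])
        have hxF : insert x {v} = F := by rw [pair_comm, ← hx, insert_erase hvF]
        have hxv : x ≠ v := fun hxv ↦ notMem_erase v F (by simp [hx, hxv])
        refine ⟨x, mem_filter.2 ⟨(mem_indepFaces.1 hF).1 (by simp [← hxF]), by simpa using hxv,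
          hxF ▸ hF⟩, hxF⟩
    · intro F hF
      obtain ⟨hF, hF2⟩ := mem_filter.1 hF
      refine Eq.trans (congrArg card ?_) hF2
      ext x
      simpa [mem_bipartiteBelow] using fun hx ↦ (mem_indepFaces.1 hF).1 hx
  have hcount1 : #((indepFaces H S).filter (#· = 1)) = 5 := by
    rw [← hS]
    refine (card_bij (fun v _ ↦ {v}) ?_ ?_ ?_).symm
    · intro v hv
      simp [mem_indepFaces, hv]
    · intro v _ w _ hvw
      simpa using hvw
    · intro F hF
      obtain ⟨hF, hF1⟩ := mem_filter.1 hF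
      obtain ⟨v, rfl⟩ := card_eq_one.1 hF1
      exact ⟨v, by simpa using (mem_indepFaces.1 hF).1, rfl⟩
  have hcount0 : #((indepFaces H S).filter (#· = 0)) = 1 := by
    rw [card_eq_one]
    refine ⟨∅, ?_⟩
    ext F
    simp only [mem_filter, card_eq_zero, mem_singleton]
    exact ⟨fun h ↦ h.2, fun h ↦ ⟨h ▸ empty_mem_indepFaces, h⟩⟩
  unfold hPoly
  rw [← sum_fiberwise_of_maps_to (t := range 3) (g := card)
    fun F hF ↦ mem_range.2 (Nat.lt_succ_of_le (h.card_le F hF))]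
  have : ∀ j, ∑ F ∈ (indepFaces H S).filter (#· = j), (X : ℤ[X]) ^ #F * (1 - X) ^ (2 - #F) =
      #((indepFaces H S).filter (#· = j)) • (X ^ j * (1 - X) ^ (2 - j)) := fun j ↦
    sum_eq_card_nsmul fun F hF ↦ by rw [(mem_filter.1 hF).2]
  simp only [this, sum_range_succ, sum_range_zero, hcount, hcount1, hcount0]
  simp only [nsmul_eq_mul]
  push_cast
  ring

/-- Outside dimension one, a flag pseudomanifold with `γ₁ = 1` has a vertex with a unique
non-neighbour. -/
lemma exists_filter_adj_eq_singleton (h : IsFlagPseudomanifold H S (d + 3))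
    (hS : #S = 2 * (d + 3) + 1) : ∃ v ∈ S, ∃ w, S.filter (H.Adj v) = {w} := by
  by_contra! hno
  have hdeg : ∀ v ∈ S, #(S.filter (H.Adj v)) = 2 := fun v hv ↦ by
    have h1 := h.one_le_card_adj hv
    have h2 := card_indepLink (H := H) hv
    have h3 := (h.link hv).two_mul_le_card
    have h4 : #(S.filter (H.Adj v)) ≠ 1 := fun h4 ↦ by
      obtain ⟨w, hw⟩ := card_eq_one.1 h4
      exact hno v hv w hw
    omega
  obtain ⟨v, hv⟩ : S.Nonempty := card_pos.1 (by omega)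
  have hlink := h.link hv
  have hcard := card_indepLink (H := H) hv
  rw [hdeg v hv] at hcard
  have hle : ∀ a, H.Adj v a → a ∈ S → #((indepLink H S v).filter (H.Adj a)) ≤ 1 := by
    intro a hva haS
    have hsub : (indepLink H S v).filter (H.Adj a) ⊆ (S.filter (H.Adj a)).erase v := by
      intro x hx
      simp only [mem_filter, mem_indepLink, mem_erase] at hx ⊢
      tauto
    refine (card_le_card hsub).trans ?_
    rw [card_erase_of_mem (mem_filter.2 ⟨hv, hva.symm⟩), hdeg a haS]
  obtain ⟨a, b, -, hab⟩ := card_eq_two.1 (hdeg v hv)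
  have ha : a ∈ S.filter (H.Adj v) := by simp [hab]
  have hb : b ∈ S.filter (H.Adj v) := by simp [hab]
  rw [mem_filter] at ha hb
  have hcover : indepLink H S v ⊆
      (indepLink H S v).filter (H.Adj a) ∪ (indepLink H S v).filter (H.Adj b) := by
    intro x hx
    have hxS := indepLink_subset hx
    have h1 := card_indepLink (H := H) hx
    have h2 := (hlink.link hx).two_mul_le_card
    obtain ⟨y, hy, hyT⟩ : ∃ y ∈ S.filter (H.Adj x), y ∉ (indepLink H S v).filter (H.Adj x) :=
      exists_mem_notMem_of_card_lt_card (by rw [hdeg x hxS]; omega)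
    obtain ⟨hyS, hxy⟩ := mem_filter.1 hy
    have hyv : y ≠ v := by
      rintro rfl
      exact (mem_indepLink.1 hx).2.2 hxy.symm
    have hvy : y ∈ S.filter (H.Adj v) := by
      refine mem_filter.2 ⟨hyS, ?_⟩
      by_contra hvy
      exact hyT (mem_filter.2 ⟨mem_indepLink.2 ⟨hyS, hyv, hvy⟩, hxy⟩)
    rw [hab, mem_insert, mem_singleton] at hvy
    rcases hvy with rfl | rfl
    · exact mem_union_left _ (mem_filter.2 ⟨hx, hxy.symm⟩)
    · exact mem_union_right _ (mem_filter.2 ⟨hx, hxy.symm⟩)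
  have h1 := (card_le_card hcover).trans (card_union_le _ _)
  have h2 := hle a ha.2 ha.1
  have h3 := hle b hb.2 hb.1
  omega

theorem hPoly_eq (h : IsFlagPseudomanifold H S (d + 2)) (hS : #S = 2 * (d + 2) + 1) :
    hPoly (d + 2) (indepFaces H S) = (1 + X) ^ (d + 2) + X * (1 + X) ^ d := by
  induction d generalizing S with
  | zero => simpa using h.hPoly_two hS
  | succ d ih =>
    obtain ⟨v, hv, w, hvw⟩ := h.exists_filter_adj_eq_singleton hS
    have hcard := card_indepLink (H := H) hv
    rw [hvw, card_singleton] at hcard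
    rw [h.hPoly_succ hv hvw, ih (h.link hv) (by omega)]
    ring

end IsFlagPseudomanifold

end GammaOne

/-- A flag simplicial complex of dimension `d-1` (`d ≥ 2`) whose geometric
realization is homeomorphic to the sphere `S^{d-1}` and which has exactly `2d+1`
vertices (i.e. `γ₁(Δ) = 1`) has `h(Δ;t) = (1+t)^d + t(1+t)^{d-2}`, i.e.
`γ(Δ;t) = 1 + t`. -/
theorem flag_sphere_gamma_one (d : ℕ) (hd : 2 ≤ d)
    (Δ : Finset (Finset (Fin (2 * d + 1))))
    (h_empty : ∅ ∈ Δ)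
    (h_down : ∀ F ∈ Δ, ∀ G ⊆ F, G ∈ Δ)
    (h_vert : ∀ p : Fin (2 * d + 1), ({p} : Finset (Fin (2 * d + 1))) ∈ Δ)
    (h_flag : ∀ F : Finset (Fin (2 * d + 1)),
      (∀ a ∈ F, ∀ b ∈ F, a ≠ b → ({a, b} : Finset (Fin (2 * d + 1))) ∈ Δ) → F ∈ Δ)
    (h_dim : ∀ F ∈ Δ, F.card ≤ d)
    (h_top : ∃ F ∈ Δ, F.card = d)
    (h_sphere : Nonempty
      (realize Δ ≃ₜ Metric.sphere (0 : EuclideanSpace ℝ (Fin d)) 1)) :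
    hPoly d Δ = (1 + X) ^ d + X * (1 + X) ^ (d - 2) := by
  obtain ⟨m, rfl⟩ := Nat.exists_eq_add_of_le' hd
  obtain ⟨e⟩ := h_sphere
  have : Fact (Module.finrank ℝ (EuclideanSpace ℝ (Fin (m + 2))) = m + 1 + 1) := ⟨by simp⟩
  let := e.toOpenPartialHomeomorph.singletonChartedSpace rfl
  let := ChartedSpace.comp (EuclideanSpace ℝ (Fin (m + 1)))
    (Metric.sphere (0 : EuclideanSpace ℝ (Fin (m + 2))) 1) (realize Δ)
  let H : SimpleGraph (Fin (2 * (m + 2) + 1)) :=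
    { Adj := fun a b ↦ a ≠ b ∧ {a, b} ∉ Δ
      symm := ⟨fun a b h ↦ ⟨h.1.symm, by rw [pair_comm]; exact h.2⟩⟩
      loopless := ⟨fun a h ↦ h.1 rfl⟩ }
  have hΔ : indepFaces H univ = Δ := by
    ext F
    simp only [mem_indepFaces, subset_univ, true_and, H, not_and, not_not]
    refine ⟨h_flag F, fun hF a ha b hb _ ↦ h_down F hF _ ?_⟩
    simp [insert_subset_iff, ha, hb]
  have hH : IsFlagPseudomanifold H univ (m + 2) := by
    refine ⟨?_, ?_, ?_⟩ <;> rw [hΔ]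
    · exact h_dim
    · intro F hF hlt
      rcases F.eq_empty_or_nonempty with rfl | hne
      · exact ⟨0, notMem_empty _, by simpa using h_vert 0⟩
      · exact exists_insert_mem_of_card_le h_down (n := m + 1) (by omega) hF hne (by omega)
    · intro F hF hcard
      obtain ⟨x, hxF, -, hx⟩ := exists_insert_mem_ne h_down (n := m + 1) (by omega) hF (by omega) 0
      obtain ⟨y, hyF, hyx, hy⟩ := exists_insert_mem_ne h_down (n := m + 1) (by omega) hF (by omega) x
      refine card_eq_two.2 ⟨x, y, hyx.symm, ?_⟩
      ext z
      simp only [mem_filter, mem_univ, true_and, mem_insert, mem_singleton]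
      constructor
      · rintro ⟨hzF, hz⟩
        by_contra! hne
        exact not_three_insert_mem (n := m + 1) (by omega) (by omega) hxF hyF hzF hyx.symm
          hne.1.symm hne.2.symm hx hy hz
      · rintro (rfl | rfl)
        exacts [⟨hxF, hx⟩, ⟨hyF, hy⟩]
  rw [← hΔ]
  exact hH.hPoly_eq (by simp)
end
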